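/- arXiv:0812.4673 — 2 statements merged into one kernel-verified Lean document; each statement's English description precedes it below -/
import Mathlib

section
/- Let B be a separable, reflexive, uniformly smooth Banach space, C a closed subset of B, p ∈ [2,∞), and (v_n) a bounded sequence of L^∞(I,B) from which one can extract a subsequence (v_{k(n)}) weakly converging to v ∈ L^∞(I,B) such that for all z ∈ L^∞(I,B) and φ ∈ L¹(I,ℝ), limsup_n ∫_I ⟨J_p(z(t)+v_{k(n)}(t)) − J_p(v_{k(n)}(t)), v_{k(n)}(t)⟩ φ(t) dt ≤ ∫_I ⟨J_p(z(t)+v(t)) − J_p(v(t)), v(t)⟩ φ(t) dt. Then for every r > 0 and every bounded sequence (u_n) of L^∞(I,C) such that u_n → u strongly in L^∞(I,B) and u_n(t) ∈ P_C(u_n(t) + r v_n(t)) for a.e. t ∈ I, one has u(t) ∈ P_C(u(t) + r v(t)) for almost every t ∈ I. -/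
open MeasureTheory Set Filter Topology

noncomputable section

/-- The (set-valued) metric projection onto `C`:
`P_C(y) = {z ∈ C | ‖y - z‖ = d(y,C)}`. -/
def projSet {E : Type*} [NormedAddCommGroup E] (C : Set E) (y : E) : Set E :=
  {z | z ∈ C ∧ ‖y - z‖ = Metric.infDist y C}

/-- The proximal normal cone of `C` at `x`:
`N(C,x) = {v | ∃ s > 0, x ∈ P_C(x + s v)}`. -/
def proxNormalCone {E : Type*} [NormedAddCommGroup E] [NormedSpace ℝ E]
    (C : Set E) (x : E) : Set E :=
  {v | ∃ s : ℝ, 0 < s ∧ x ∈ projSet C (x + s • v)}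

/-- A subset is ball-compact if its intersection with every closed ball is compact. -/
def BallCompact {E : Type*} [NormedAddCommGroup E] (C : Set E) : Prop :=
  ∀ (x : E) (R : ℝ), IsCompact (C ∩ Metric.closedBall x R)

/-- A uniformly smooth normed space: the norm is uniformly Fréchet differentiable away
from `0`, expressed through the vanishing of the modulus of smoothness. -/
def UniformlySmooth (E : Type*) [NormedAddCommGroup E] [NormedSpace ℝ E] : Prop :=
  ∀ ε > (0:ℝ), ∃ δ > (0:ℝ), ∀ x y : E, ‖x‖ = 1 → ‖y‖ ≤ δ →
    ‖x + y‖ + ‖x - y‖ - 2 ≤ ε * ‖y‖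

/-- A reflexive normed space: the canonical embedding into the double dual is onto. -/
def ReflexiveSpace (E : Type*) [NormedAddCommGroup E] [NormedSpace ℝ E] : Prop :=
  Function.Surjective (NormedSpace.inclusionInDoubleDual ℝ E)

/-- The normalized duality-type mapping `J_p(x) = (1/p) (∇‖·‖^p)(x) ∈ E*`. -/
def dualMapJ {E : Type*} [NormedAddCommGroup E] [NormedSpace ℝ E]
    (p : ℝ) (x : E) : E →L[ℝ] ℝ :=
  p⁻¹ • fderiv ℝ (fun z : E => ‖z‖ ^ p) x

section DualityMap

variable {E : Type*} [NormedAddCommGroup E] [NormedSpace ℝ E]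

/-- The derivative is any norming functional of `x`. -/
theorem UniformlySmooth.exists_hasFDerivAt_norm (hE : UniformlySmooth E) {x : E} (hx : x ≠ 0) :
    ∃ g : E →L[ℝ] ℝ, ‖g‖ = 1 ∧ HasFDerivAt (fun z : E => ‖z‖) g x := by
  obtain ⟨g, hg, hgx⟩ := exists_dual_vector ℝ x (norm_ne_zero_iff.2 hx)
  have hgx : g x = ‖x‖ := by simpa using hgx
  refine ⟨g, hg, ?_⟩
  have hle : ∀ y : E, g y ≤ ‖y‖ := fun y => by
    simpa [hg] using (le_abs_self _).trans (g.le_opNorm y)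
  have hx0 : 0 < ‖x‖ := norm_pos_iff.2 hx
  rw [hasFDerivAt_iff_isLittleO_nhds_zero, Asymptotics.isLittleO_iff]
  intro ε hε
  obtain ⟨δ, hδ, h⟩ := hE ε hε
  filter_upwards [Metric.closedBall_mem_nhds (0 : E) (mul_pos hδ hx0)] with y hy
  have hy : ‖y‖ ≤ δ * ‖x‖ := by simpa using hy
  have key := h (‖x‖⁻¹ • x) (‖x‖⁻¹ • y) (by simp [norm_smul, hx0.ne'])
    (by rw [norm_smul, norm_inv, norm_norm, inv_mul_le_iff₀ hx0]; linarith)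
  rw [← smul_add, ← smul_sub] at key
  simp only [norm_smul, norm_inv, norm_norm] at key
  have key2 : ‖x + y‖ + ‖x - y‖ - 2 * ‖x‖ ≤ ε * ‖y‖ := by
    have := mul_le_mul_of_nonneg_left key hx0.le
    field_simp at this
    linarith
  have h1 := hle (x + y)
  have h2 := hle (x - y)
  simp only [map_add, map_sub, hgx] at h1 h2
  rw [Real.norm_eq_abs, abs_of_nonneg (by linarith)]
  linarith

theorem UniformlySmooth.exists_hasFDerivAt_norm_rpow (hE : UniformlySmooth E) {p : ℝ} (hp : 1 < p)
    (x : E) : ∃ g : E →L[ℝ] ℝ, ‖g‖ ≤ p * ‖x‖ ^ (p - 1) ∧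
      HasFDerivAt (fun z : E => ‖z‖ ^ p) g x := by
  rcases eq_or_ne x 0 with rfl | hx
  · refine ⟨0, by rw [norm_zero]; positivity, ?_⟩
    rw [hasFDerivAt_iff_isLittleO_nhds_zero, Asymptotics.isLittleO_iff]
    intro ε hε
    have hc : Tendsto (fun y : E => ‖y‖ ^ (p - 1)) (𝓝 0) (𝓝 0) := by
      have : Continuous (fun y : E => ‖y‖ ^ (p - 1)) :=
        continuous_norm.rpow_const fun _ => Or.inr (by linarith)
      simpa [Real.zero_rpow (by linarith : p - 1 ≠ 0)] using this.tendsto 0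
    filter_upwards [hc.eventually (gt_mem_nhds hε)] with y hy
    have hpy : ‖y‖ ^ p = ‖y‖ ^ (p - 1) * ‖y‖ := by
      rw [← Real.rpow_add_one' (norm_nonneg _) (by linarith), sub_add_cancel]
    simp only [zero_add, norm_zero, Real.zero_rpow (by linarith : p ≠ 0), sub_zero,
      zero_apply, hpy]
    rw [Real.norm_eq_abs, abs_of_nonneg (by positivity)]
    gcongr
  · obtain ⟨g, hg, hgd⟩ := hE.exists_hasFDerivAt_norm hx
    refine ⟨_, ?_, hgd.rpow_const (Or.inr hp.le)⟩
    rw [norm_smul, hg, mul_one, Real.norm_eq_abs, abs_of_nonneg (by positivity)]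

theorem UniformlySmooth.hasFDerivAt_norm_rpow (hE : UniformlySmooth E) {p : ℝ} (hp : 1 < p)
    (x : E) : HasFDerivAt (fun z : E => ‖z‖ ^ p) (p • dualMapJ p x) x := by
  obtain ⟨g, -, hg⟩ := hE.exists_hasFDerivAt_norm_rpow hp x
  rw [dualMapJ, smul_inv_smul₀ (by linarith)]
  exact hg.differentiableAt.hasFDerivAt

theorem UniformlySmooth.norm_dualMapJ_le (hE : UniformlySmooth E) {p : ℝ} (hp : 1 < p) (x : E) :
    ‖dualMapJ p x‖ ≤ ‖x‖ ^ (p - 1) := by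
  obtain ⟨g, hgn, hg⟩ := hE.exists_hasFDerivAt_norm_rpow hp x
  rw [dualMapJ, hg.fderiv, norm_smul, norm_inv, Real.norm_eq_abs, abs_of_pos (by linarith),
    inv_mul_le_iff₀ (by linarith)]
  exact hgn

theorem UniformlySmooth.dualMapJ_smul (hE : UniformlySmooth E) {p : ℝ} (hp : 1 < p) {c : ℝ}
    (hc : 0 < c) (x : E) : dualMapJ p (c • x) = c ^ (p - 1) • dualMapJ p x := by
  have h1 : HasFDerivAt (fun z : E => ‖c • z‖ ^ p)
      ((p • dualMapJ p (c • x)).comp (c • ContinuousLinearMap.id ℝ E)) x :=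
    (hE.hasFDerivAt_norm_rpow hp (c • x)).comp x ((hasFDerivAt_id x).const_smul c)
  have h2 : HasFDerivAt (fun z : E => ‖c • z‖ ^ p) (c ^ p • p • dualMapJ p x) x := by
    have : (fun z : E => ‖c • z‖ ^ p) = fun z => c ^ p • ‖z‖ ^ p := by
      ext z
      rw [norm_smul, Real.norm_eq_abs, abs_of_pos hc, Real.mul_rpow hc.le (norm_nonneg _),
        smul_eq_mul]
    rw [this]
    exact (hE.hasFDerivAt_norm_rpow hp x).const_smul (c ^ p)
  have h := h1.unique h2
  ext y
  have hy := DFunLike.congr_fun h y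
  have hcp : c ^ p = c ^ (p - 1) * c := by
    rw [← Real.rpow_add_one hc.ne', sub_add_cancel]
  simp only [ContinuousLinearMap.comp_apply, smul_apply,
    ContinuousLinearMap.id_apply, map_smul, smul_eq_mul, hcp] at hy ⊢
  have hp0 : p ≠ 0 := by linarith
  have : p * c ≠ 0 := mul_ne_zero hp0 hc.ne'
  apply mul_left_cancel₀ this
  linarith

theorem UniformlySmooth.abs_dualMapJ_apply_le (hE : UniformlySmooth E) {p R : ℝ} (hp : 1 < p)
    {x y : E} (hx : ‖x‖ ≤ R) (hy : ‖y‖ ≤ R) : |dualMapJ p x y| ≤ R ^ (p - 1) * R := by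
  have hR : 0 ≤ R := (norm_nonneg x).trans hx
  calc |dualMapJ p x y| ≤ ‖dualMapJ p x‖ * ‖y‖ := (dualMapJ p x).le_opNorm y
    _ ≤ ‖x‖ ^ (p - 1) * ‖y‖ := by gcongr; exact hE.norm_dualMapJ_le hp x
    _ ≤ R ^ (p - 1) * R := by gcongr

theorem UniformlySmooth.aestronglyMeasurable_dualMapJ (hE : UniformlySmooth E) {p : ℝ} (hp : 1 < p)
    {α : Type*} [MeasurableSpace α] {μ : Measure α} {f g : α → E}
    (hf : AEStronglyMeasurable f μ) (hg : AEStronglyMeasurable g μ) :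
    AEStronglyMeasurable (fun t => dualMapJ p (f t) (g t)) μ := by
  have hG : Continuous fun z : E => ‖z‖ ^ p :=
    continuous_norm.rpow_const fun _ => Or.inr (by linarith)
  refine aestronglyMeasurable_of_tendsto_ae (u := atTop)
    (f := fun (n : ℕ) t => p⁻¹ * ((n : ℝ) • (‖f t + (n : ℝ)⁻¹ • g t‖ ^ p - ‖f t‖ ^ p)))
    (fun n => ?_) (ae_of_all _ fun t => ?_)
  · exact (((hG.comp_aestronglyMeasurable (hf.add (hg.const_smul _))).sub
      (hG.comp_aestronglyMeasurable hf)).const_smul (n : ℝ)).const_mul _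
  · have := (hE.hasFDerivAt_norm_rpow hp (f t)).lim (g t) (c := fun n : ℕ => (n : ℝ)) (l := atTop)
      (by simpa using tendsto_natCast_atTop_atTop)
    have := this.const_mul p⁻¹
    simpa [inv_mul_cancel_left₀ (by linarith : p ≠ 0)] using this

/-- The integrand is `d/dσ (‖σ v + w‖ ^ p - ‖σ v‖ ^ p) / p`. -/
theorem UniformlySmooth.norm_add_rpow_sub_norm_rpow (hE : UniformlySmooth E) {p : ℝ} (hp : 1 < p)
    (v w : E) : ‖v + w‖ ^ p - ‖v‖ ^ p =
      ‖w‖ ^ p + p * ∫ σ in Ioc (0 : ℝ) 1, (dualMapJ p (σ • v + w) - dualMapJ p (σ • v)) v := by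
  have hd : ∀ w : E, ∀ σ : ℝ, HasDerivAt (fun σ : ℝ => ‖σ • v + w‖ ^ p)
      (p * dualMapJ p (σ • v + w) v) σ := fun w σ => by
    have h1 : HasDerivAt (fun σ : ℝ => σ • v + w) v σ := by
      simpa using ((hasDerivAt_id σ).smul_const v).add_const w
    exact (hE.hasFDerivAt_norm_rpow hp (σ • v + w)).comp_hasDerivAt σ h1
  have hd2 : ∀ σ : ℝ, HasDerivAt (fun σ : ℝ => ‖σ • v + w‖ ^ p - ‖σ • v‖ ^ p)
      (p * (dualMapJ p (σ • v + w) - dualMapJ p (σ • v)) v) σ := fun σ => by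
    have := (hd w σ).sub (hd 0 σ)
    simp only [add_zero, ← mul_sub] at this
    exact this
  have hm : ∀ w : E, AEStronglyMeasurable (fun σ : ℝ => dualMapJ p (σ • v + w) v)
      (volume.restrict (Ioc (0 : ℝ) 1)) := fun w =>
    hE.aestronglyMeasurable_dualMapJ hp
      (by fun_prop : Continuous fun σ : ℝ => σ • v + w).aestronglyMeasurable
      aestronglyMeasurable_const
  have hi : ∀ w : E, IntegrableOn (fun σ : ℝ => dualMapJ p (σ • v + w) v) (Ioc 0 1) := fun w => by
    refine Integrable.of_bound (hm w) ((‖v‖ + ‖w‖) ^ (p - 1) * (‖v‖ + ‖w‖)) ?_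
    filter_upwards [ae_restrict_mem measurableSet_Ioc] with σ hσ
    refine hE.abs_dualMapJ_apply_le hp ?_ (by linarith [norm_nonneg w])
    refine (norm_add_le _ _).trans ?_
    rw [norm_smul, Real.norm_eq_abs, abs_of_pos hσ.1]
    nlinarith [hσ.2, norm_nonneg v]
  have hi2 : IntervalIntegrable
      (fun σ => p * (dualMapJ p (σ • v + w) - dualMapJ p (σ • v)) v) volume 0 1 := by
    rw [intervalIntegrable_iff_integrableOn_Ioc_of_le zero_le_one]
    have := ((hi w).sub (hi 0)).const_mul p
    simp only [add_zero] at this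
    exact this
  have := intervalIntegral.integral_eq_sub_of_hasDerivAt (fun σ _ => hd2 σ) hi2
  rw [intervalIntegral.integral_of_le zero_le_one, integral_const_mul] at this
  rw [this]
  simp [Real.zero_rpow (by linarith : p ≠ 0)]

theorem UniformlySmooth.dualMapJ_sub_apply_eq (hE : UniformlySmooth E) {p : ℝ} (hp : 1 < p)
    {σ : ℝ} (hσ : 0 < σ) (v w : E) : (dualMapJ p (σ • v + w) - dualMapJ p (σ • v)) v =
      σ ^ (p - 1) * (dualMapJ p (σ⁻¹ • w + v) - dualMapJ p v) v := by
  have h : σ • v + w = σ • (σ⁻¹ • w + v) := by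
    rw [smul_add, smul_inv_smul₀ hσ.ne', add_comm]
  rw [h, hE.dualMapJ_smul hp hσ, hE.dualMapJ_smul hp hσ]
  simp only [sub_apply, smul_apply, smul_eq_mul, mul_sub]

theorem UniformlySmooth.abs_dualMapJ_sub_apply_le (hE : UniformlySmooth E) {p R : ℝ} (hp : 1 < p)
    {x y z : E} (hx : ‖x‖ ≤ R) (hy : ‖y‖ ≤ R) (hz : ‖z‖ ≤ R) :
    |(dualMapJ p x - dualMapJ p y) z| ≤ 2 * (R ^ (p - 1) * R) := by
  rw [sub_apply]
  linarith [abs_sub (dualMapJ p x z) (dualMapJ p y z), hE.abs_dualMapJ_apply_le hp hx hz,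
    hE.abs_dualMapJ_apply_le hp hy hz]

theorem UniformlySmooth.abs_dualMapJ_smul_add_sub_mul_le (hE : UniformlySmooth E) {p R : ℝ}
    (hp : 1 < p) {σ : ℝ} (hσ : σ ∈ Ioc (0 : ℝ) 1) {v w : E} (hv : ‖v‖ ≤ R) (hw : ‖w‖ ≤ R)
    {s : ℝ} (hs : |s| ≤ 1) :
    |(dualMapJ p (σ • v + w) - dualMapJ p (σ • v)) v * s| ≤
      2 * ((2 * R) ^ (p - 1) * (2 * R)) := by
  have hσv : ‖σ • v‖ ≤ R := by
    rw [norm_smul, Real.norm_eq_abs, abs_of_pos hσ.1]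
    nlinarith [hσ.2, norm_nonneg v]
  have hR : 0 ≤ R := (norm_nonneg _).trans hv
  rw [abs_mul]
  refine (mul_le_of_le_one_right (abs_nonneg _) hs).trans
    (hE.abs_dualMapJ_sub_apply_le hp ?_ (by linarith) (by linarith))
  linarith [norm_add_le (σ • v) w]

section Integrals

variable {α : Type*} [MeasurableSpace α] {μ : Measure α} [IsFiniteMeasure μ]
  {v w : α → E} {φ : α → ℝ} {p R : ℝ}

theorem UniformlySmooth.integrable_prod_dualMapJ (hE : UniformlySmooth E) (hp : 1 < p)
    (hv : AEStronglyMeasurable v μ) (hw : AEStronglyMeasurable w μ)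
    (hvR : ∀ᵐ t ∂μ, ‖v t‖ ≤ R) (hwR : ∀ᵐ t ∂μ, ‖w t‖ ≤ R)
    (hφ : AEStronglyMeasurable φ μ) (hφ1 : ∀ t, |φ t| ≤ 1) :
    Integrable (fun q : ℝ × α =>
      (dualMapJ p (q.1 • v q.2 + w q.2) - dualMapJ p (q.1 • v q.2)) (v q.2) * φ q.2)
      ((volume.restrict (Ioc 0 1)).prod μ) := by
  set ν := (volume.restrict (Ioc (0 : ℝ) 1)).prod μ
  have hv' : AEStronglyMeasurable (fun q : ℝ × α => v q.2) ν := hv.comp_snd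
  have hw' : AEStronglyMeasurable (fun q : ℝ × α => w q.2) ν := hw.comp_snd
  have hs : AEStronglyMeasurable (fun q : ℝ × α => q.1 • v q.2) ν :=
    measurable_fst.aestronglyMeasurable.smul hv'
  refine Integrable.of_bound (((hE.aestronglyMeasurable_dualMapJ hp (hs.add hw') hv').sub
    (hE.aestronglyMeasurable_dualMapJ hp hs hv')).mul hφ.comp_snd)
    (2 * ((2 * R) ^ (p - 1) * (2 * R))) ?_
  filter_upwards [Measure.quasiMeasurePreserving_fst.ae (ae_restrict_mem measurableSet_Ioc),
    Measure.quasiMeasurePreserving_snd.ae hvR, Measure.quasiMeasurePreserving_snd.ae hwR]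
    with q h1 h2 h3
  exact hE.abs_dualMapJ_smul_add_sub_mul_le hp h1 h2 h3 (hφ1 _)

theorem UniformlySmooth.integral_norm_add_rpow_sub_norm_rpow (hE : UniformlySmooth E) (hp : 1 < p)
    (hv : AEStronglyMeasurable v μ) (hw : AEStronglyMeasurable w μ)
    (hvR : ∀ᵐ t ∂μ, ‖v t‖ ≤ R) (hwR : ∀ᵐ t ∂μ, ‖w t‖ ≤ R)
    (hφ : AEStronglyMeasurable φ μ) (hφ1 : ∀ t, |φ t| ≤ 1) :
    ∫ t, (‖v t + w t‖ ^ p - ‖v t‖ ^ p) * φ t ∂μ = ∫ t, ‖w t‖ ^ p * φ t ∂μ +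
      p * ∫ σ in Ioc (0 : ℝ) 1, σ ^ (p - 1) *
        ∫ t, (dualMapJ p (σ⁻¹ • w t + v t) - dualMapJ p (v t)) (v t) * φ t ∂μ := by
  have hI := hE.integrable_prod_dualMapJ hp hv hw hvR hwR hφ hφ1
  have hwi : Integrable (fun t => ‖w t‖ ^ p * φ t) μ := by
    refine Integrable.of_bound (((continuous_norm.rpow_const fun _ =>
      Or.inr (by linarith)).comp_aestronglyMeasurable hw).mul hφ) (R ^ p) ?_
    filter_upwards [hwR] with t ht
    rw [norm_mul, Real.norm_eq_abs, abs_of_nonneg (by positivity)]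
    refine (mul_le_of_le_one_right (by positivity) (hφ1 t)).trans ?_
    gcongr
  have hpt : ∀ t, (‖v t + w t‖ ^ p - ‖v t‖ ^ p) * φ t = ‖w t‖ ^ p * φ t +
      p * ∫ σ in Ioc (0 : ℝ) 1,
        (dualMapJ p (σ • v t + w t) - dualMapJ p (σ • v t)) (v t) * φ t := fun t => by
    rw [hE.norm_add_rpow_sub_norm_rpow hp, integral_mul_const]
    ring
  simp_rw [hpt]
  rw [integral_add hwi (hI.integral_prod_right.const_mul p), integral_const_mul,
    integral_integral_swap (f := fun t σ =>
      (dualMapJ p (σ • v t + w t) - dualMapJ p (σ • v t)) (v t) * φ t) hI.swap]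
  congr 2
  refine setIntegral_congr_fun measurableSet_Ioc fun σ hσ => ?_
  rw [← integral_const_mul]
  congr 1 with t
  rw [hE.dualMapJ_sub_apply_eq hp hσ.1, mul_assoc]

theorem UniformlySmooth.tendsto_integral_norm_add_rpow_sub_norm_rpow (hE : UniformlySmooth E)
    (hp : 1 < p) {vseq : ℕ → α → E}
    (hvseq : ∀ n, AEStronglyMeasurable (vseq n) μ) (hv : AEStronglyMeasurable v μ)
    (hw : AEStronglyMeasurable w μ) (hvseqR : ∀ n, ∀ᵐ t ∂μ, ‖vseq n t‖ ≤ R)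
    (hvR : ∀ᵐ t ∂μ, ‖v t‖ ≤ R) (hwR : ∀ᵐ t ∂μ, ‖w t‖ ≤ R)
    (hφ : AEStronglyMeasurable φ μ) (hφ1 : ∀ t, |φ t| ≤ 1)
    (hlim : ∀ c : ℝ, 0 < c → Tendsto (fun n =>
      ∫ t, (dualMapJ p (c • w t + vseq n t) - dualMapJ p (vseq n t)) (vseq n t) * φ t ∂μ) atTop
      (𝓝 (∫ t, (dualMapJ p (c • w t + v t) - dualMapJ p (v t)) (v t) * φ t ∂μ))) :
    Tendsto (fun n => ∫ t, (‖vseq n t + w t‖ ^ p - ‖vseq n t‖ ^ p) * φ t ∂μ) atTop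
      (𝓝 (∫ t, (‖v t + w t‖ ^ p - ‖v t‖ ^ p) * φ t ∂μ)) := by
  have hscale : ∀ {u : α → E} {σ : ℝ}, σ ∈ Ioc (0 : ℝ) 1 →
      ∫ t, (dualMapJ p (σ • u t + w t) - dualMapJ p (σ • u t)) (u t) * φ t ∂μ = σ ^ (p - 1) *
        ∫ t, (dualMapJ p (σ⁻¹ • w t + u t) - dualMapJ p (u t)) (u t) * φ t ∂μ :=
    fun hσ => by
      rw [← integral_const_mul]
      congr 1 with t
      rw [hE.dualMapJ_sub_apply_eq hp hσ.1, mul_assoc]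
  simp_rw [fun n => hE.integral_norm_add_rpow_sub_norm_rpow hp (hvseq n) hw (hvseqR n) hwR hφ hφ1,
    hE.integral_norm_add_rpow_sub_norm_rpow hp hv hw hvR hwR hφ hφ1]
  refine ((tendsto_integral_of_dominated_convergence
    (fun _ => 2 * ((2 * R) ^ (p - 1) * (2 * R)) * μ.real univ)
    (fun n => ?_) (integrable_const _) (fun n => ?_) ?_).const_mul p).const_add _
  · refine (hE.integrable_prod_dualMapJ hp (hvseq n) hw (hvseqR n) hwR hφ
      hφ1).integral_prod_left.aestronglyMeasurable.congr ?_
    filter_upwards [ae_restrict_mem measurableSet_Ioc] with σ hσ using hscale hσ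
  · filter_upwards [ae_restrict_mem measurableSet_Ioc] with σ hσ
    rw [← hscale hσ]
    refine norm_integral_le_of_norm_le_const ?_
    filter_upwards [hvseqR n, hwR] with t h1 h2
    exact hE.abs_dualMapJ_smul_add_sub_mul_le hp hσ h1 h2 (hφ1 t)
  · filter_upwards [ae_restrict_mem measurableSet_Ioc] with σ hσ
    exact (hlim σ⁻¹ (inv_pos.2 hσ.1)).const_mul _

end Integrals

end DualityMap

theorem tendsto_of_limsup_le_of_limsup_neg_le {x : ℕ → ℝ} {l K : ℝ} (hK : ∀ n, |x n| ≤ K)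
    (h1 : limsup x atTop ≤ l) (h2 : limsup (fun n => -x n) atTop ≤ -l) :
    Tendsto x atTop (𝓝 l) := by
  have hb1 : IsBoundedUnder (· ≤ ·) atTop x := isBoundedUnder_of ⟨K, fun n => (abs_le.1 (hK n)).2⟩
  have hb2 : IsBoundedUnder (· ≤ ·) atTop fun n => -x n :=
    isBoundedUnder_of ⟨K, fun n => by linarith [(abs_le.1 (hK n)).1]⟩
  refine tendsto_order.2 ⟨fun c hc => ?_, fun c hc =>
    eventually_lt_of_limsup_lt (h1.trans_lt hc) hb1⟩
  filter_upwards [eventually_lt_of_limsup_lt (h2.trans_lt (neg_lt_neg hc)) hb2] with n hn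
  linarith

theorem exists_pos_rpow_sub_rpow_ge {p R ε : ℝ} (hp : 0 ≤ p) (hε : 0 < ε) :
    ∃ δ > (0 : ℝ), ∀ x y : ℝ, 0 ≤ x → x ≤ R → 0 ≤ y → x - δ ≤ y → -ε ≤ y ^ p - x ^ p := by
  have hu := isCompact_Icc.uniformContinuousOn_of_continuous
    ((Real.continuous_rpow_const hp).continuousOn (s := Icc 0 R))
  obtain ⟨δ, hδ, h⟩ := Metric.uniformContinuousOn_iff_le.1 hu ε hε
  refine ⟨δ, hδ, fun x y hx hxR hy hxy => ?_⟩
  rcases le_total x y with hle | hle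
  · linarith [Real.rpow_le_rpow hx hle hp]
  · have := h y ⟨hy, hle.trans hxR⟩ x ⟨hx, hxR⟩
      (by rw [Real.dist_eq, abs_le]; constructor <;> linarith)
    rw [Real.dist_eq] at this
    exact (abs_le.1 this).1

theorem mem_projSet_add_smul_iff {E : Type*} [NormedAddCommGroup E] [NormedSpace ℝ E] {C : Set E}
    {x v : E} {r : ℝ} (hr : 0 < r) (hx : x ∈ C) :
    x ∈ projSet C (x + r • v) ↔ ∀ z ∈ C, ‖v‖ ≤ ‖v + r⁻¹ • (x - z)‖ := by
  have hdist : ∀ z, dist (x + r • v) z = r * ‖v + r⁻¹ • (x - z)‖ := fun z => by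
    rw [← abs_of_pos hr, ← Real.norm_eq_abs, ← norm_smul, smul_add, Real.norm_eq_abs,
      abs_of_pos hr, smul_inv_smul₀ hr.ne', dist_eq_norm]
    congr 1
    abel
  have hself : ‖x + r • v - x‖ = r * ‖v‖ := by
    rw [add_sub_cancel_left, norm_smul, Real.norm_eq_abs, abs_of_pos hr]
  have hle : Metric.infDist (x + r • v) C ≤ r * ‖v‖ := by
    rw [← hself, ← dist_eq_norm]
    exact Metric.infDist_le_dist_of_mem hx
  constructor
  · rintro ⟨-, h⟩ z hz
    have := Metric.infDist_le_dist_of_mem (x := x + r • v) hz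
    rw [← h, hself, hdist] at this
    exact le_of_mul_le_mul_left this hr
  · refine fun h => ⟨hx, le_antisymm ?_ (hle.trans_eq hself.symm)⟩
    rw [hself, Metric.le_infDist ⟨x, hx⟩]
    intro z hz
    rw [hdist]
    exact mul_le_mul_of_nonneg_left (h z hz) hr.le

/-- **Weak continuity of the projection.** Let `B` be a separable, reflexive, uniformly
smooth Banach space, `C ⊂ B` closed and `p ∈ [2,∞)`. Let `(v_n)` be a bounded sequence
of `L^∞(I,B)` admitting a subsequence `(v_{k(n)})` weakly-* converging (through the
duality `L^∞(I,B) = (L¹(I,B*))*`) to some `v ∈ L^∞(I,B)` along which the `limsup`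
inequality for the `J_p`-quantities holds. Then for every `r > 0` and every bounded
sequence `(u_n)` of `L^∞(I,C)` with `u_n → u` strongly in `L^∞(I,B)` and
`u_n(t) ∈ P_C(u_n(t) + r v_n(t))` a.e. on `I`, one has
`u(t) ∈ P_C(u(t) + r v(t))` for a.e. `t ∈ I`. -/
theorem proj_weak_continuity
    {B : Type*} [NormedAddCommGroup B] [NormedSpace ℝ B] [CompleteSpace B]
    [TopologicalSpace.SeparableSpace B]
    (hrefl : ReflexiveSpace B) (hsmooth : UniformlySmooth B)
    (a b : ℝ) (C : Set B) (hC : IsClosed C) (p : ℝ) (hp : 2 ≤ p)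
    -- the bounded sequence `(v_n)` of `L^∞(I,B)`
    (vseq : ℕ → ℝ → B)
    (hvmeas : ∀ n, AEStronglyMeasurable (vseq n) (volume.restrict (Set.Icc a b)))
    (hvbdd : ∃ M : ℝ, ∀ n, ∀ᵐ t ∂volume.restrict (Set.Icc a b), ‖vseq n t‖ ≤ M)
    -- the extracted subsequence `(v_{k(n)})` and its weak-* limit `v`
    (k : ℕ → ℕ) (hk : StrictMono k) (v : ℝ → B)
    (hvlimmeas : AEStronglyMeasurable v (volume.restrict (Set.Icc a b)))
    (hvlimbdd : ∃ M : ℝ, ∀ᵐ t ∂volume.restrict (Set.Icc a b), ‖v t‖ ≤ M)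
    (hweak : ∀ g : ℝ → (B →L[ℝ] ℝ), Integrable g (volume.restrict (Set.Icc a b)) →
      Tendsto (fun n => ∫ t, g t (vseq (k n) t) ∂volume.restrict (Set.Icc a b)) atTop
        (𝓝 (∫ t, g t (v t) ∂volume.restrict (Set.Icc a b))))
    -- the `limsup` inequality for the `J_p`-quantities
    (hlimsup : ∀ z : ℝ → B, AEStronglyMeasurable z (volume.restrict (Set.Icc a b)) →
      (∃ M : ℝ, ∀ᵐ t ∂volume.restrict (Set.Icc a b), ‖z t‖ ≤ M) →
      ∀ φ : ℝ → ℝ, Integrable φ (volume.restrict (Set.Icc a b)) →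
        Filter.limsup (fun n => ∫ t,
            (dualMapJ p (z t + vseq (k n) t) - dualMapJ p (vseq (k n) t)) (vseq (k n) t)
              * φ t ∂volume.restrict (Set.Icc a b)) atTop ≤
          ∫ t, (dualMapJ p (z t + v t) - dualMapJ p (v t)) (v t) * φ t
            ∂volume.restrict (Set.Icc a b))
    -- the bounded sequence `(u_n)` of `L^∞(I,C)` and its strong limit `u`
    (r : ℝ) (hr : 0 < r) (useq : ℕ → ℝ → B) (u : ℝ → B)
    (humeas : ∀ n, AEStronglyMeasurable (useq n) (volume.restrict (Set.Icc a b)))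
    (huC : ∀ n, ∀ᵐ t ∂volume.restrict (Set.Icc a b), useq n t ∈ C)
    (hubdd : ∃ M : ℝ, ∀ n, ∀ᵐ t ∂volume.restrict (Set.Icc a b), ‖useq n t‖ ≤ M)
    (hustrong : ∀ ε > (0:ℝ), ∃ N : ℕ, ∀ n ≥ N,
      ∀ᵐ t ∂volume.restrict (Set.Icc a b), ‖useq n t - u t‖ ≤ ε)
    (huproj : ∀ n, ∀ᵐ t ∂volume.restrict (Set.Icc a b),
      useq n t ∈ projSet C (useq n t + r • vseq n t)) :
    ∀ᵐ t ∂volume.restrict (Set.Icc a b), u t ∈ projSet C (u t + r • v t) := by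
  have hp1 : 1 < p := by linarith
  have hp0 : 0 ≤ p := by linarith
  set μ := volume.restrict (Set.Icc a b)
  obtain ⟨M₁, hM₁⟩ := hvbdd
  obtain ⟨M₂, hM₂⟩ := hvlimbdd
  obtain ⟨M₃, hM₃⟩ := hubdd
  have hunif : ∀ᵐ t ∂μ, Tendsto (fun n => useq n t) atTop (𝓝 (u t)) := by
    choose N hN using fun m : ℕ => hustrong (1 / ((m : ℝ) + 1)) Nat.one_div_pos_of_nat
    have hall : ∀ᵐ t ∂μ, ∀ m n, N m ≤ n → ‖useq n t - u t‖ ≤ 1 / ((m : ℝ) + 1) := by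
      refine ae_all_iff.2 fun m => ae_all_iff.2 fun n => ?_
      by_cases hn : N m ≤ n
      · filter_upwards [hN m n hn] with t ht _ using ht
      · exact ae_of_all _ fun t h => absurd h hn
    filter_upwards [hall] with t ht
    rw [Metric.tendsto_atTop]
    intro ε hε
    obtain ⟨m, hm⟩ := exists_nat_one_div_lt hε
    exact ⟨N m, fun n hn => by rw [dist_eq_norm]; exact (ht m n hn).trans_lt hm⟩
  have hum : AEStronglyMeasurable u μ := aestronglyMeasurable_of_tendsto_ae atTop humeas hunif
  have huR : ∀ᵐ t ∂μ, ‖u t‖ ≤ M₃ := by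
    filter_upwards [hunif, ae_all_iff.2 hM₃] with t ht h
    exact le_of_tendsto ht.norm (Eventually.of_forall h)
  have huC' : ∀ᵐ t ∂μ, u t ∈ C := by
    filter_upwards [hunif, ae_all_iff.2 huC] with t ht h
    exact hC.mem_of_tendsto ht (Eventually.of_forall h)
  have key : ∀ z ∈ C, ∀ᵐ t ∂μ, ‖v t‖ ≤ ‖v t + r⁻¹ • (u t - z)‖ := by
    intro z hz
    set w : ℝ → B := fun t => r⁻¹ • (u t - z)
    have hwm : AEStronglyMeasurable w μ := (hum.sub aestronglyMeasurable_const).const_smul _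
    have hwR : ∀ᵐ t ∂μ, ‖w t‖ ≤ r⁻¹ * (M₃ + ‖z‖) := by
      filter_upwards [huR] with t ht
      rw [norm_smul, norm_inv, Real.norm_eq_abs, abs_of_pos hr]
      gcongr
      linarith [norm_sub_le (u t) z]
    have hconv : ∀ φ : ℝ → ℝ, AEStronglyMeasurable φ μ → (∀ t, |φ t| ≤ 1) →
        Tendsto (fun n => ∫ t, (‖vseq (k n) t + w t‖ ^ p - ‖vseq (k n) t‖ ^ p) * φ t ∂μ) atTop
          (𝓝 (∫ t, (‖v t + w t‖ ^ p - ‖v t‖ ^ p) * φ t ∂μ)) := by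
      intro φ hφ hφ1
      have hφi : Integrable φ μ := Integrable.of_bound hφ 1 (ae_of_all _ hφ1)
      refine hsmooth.tendsto_integral_norm_add_rpow_sub_norm_rpow hp1
        (R := max M₁ (max M₂ (r⁻¹ * (M₃ + ‖z‖)))) (fun n => hvmeas _) hvlimmeas hwm
        (fun n => (hM₁ _).mono fun t ht => ht.trans (le_max_left _ _))
        (hM₂.mono fun t ht => ht.trans ((le_max_left _ _).trans (le_max_right _ _)))
        (hwR.mono fun t ht => ht.trans ((le_max_right _ _).trans (le_max_right _ _)))
        hφ hφ1 fun c hc => ?_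
      have hcwR : ∀ᵐ t ∂μ, ‖c • w t‖ ≤ c * (r⁻¹ * (M₃ + ‖z‖)) := by
        filter_upwards [hwR] with t ht
        rw [norm_smul, Real.norm_eq_abs, abs_of_pos hc]
        gcongr
      set S := max M₁ (M₁ + c * (r⁻¹ * (M₃ + ‖z‖)))
      refine tendsto_of_limsup_le_of_limsup_neg_le
        (K := 2 * (S ^ (p - 1) * S) * μ.real univ) (fun n => ?_)
        (hlimsup (fun t => c • w t) (hwm.const_smul c) ⟨_, hcwR⟩ φ hφi) ?_
      · rw [← Real.norm_eq_abs]
        refine norm_integral_le_of_norm_le_const ?_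
        filter_upwards [hM₁ (k n), hcwR] with t h1 h2
        have h1' := h1.trans (le_max_left M₁ (M₁ + c * (r⁻¹ * (M₃ + ‖z‖))))
        rw [norm_mul]
        refine (mul_le_of_le_one_right (norm_nonneg _) (hφ1 t)).trans
          (hsmooth.abs_dualMapJ_sub_apply_le hp1 ?_ h1' h1')
        refine le_trans ?_ (le_max_right _ _)
        linarith [norm_add_le (c • w t) (vseq (k n) t)]
      · have := hlimsup (fun t => c • w t) (hwm.const_smul c) ⟨_, hcwR⟩ _ hφi.neg
        simpa only [Pi.neg_apply, mul_neg, integral_neg] using this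
    have hpow : ∀ {f : ℝ → B} {K : ℝ}, AEStronglyMeasurable f μ → (∀ᵐ t ∂μ, ‖f t‖ ≤ K) →
        Integrable (fun t => ‖f t‖ ^ p) μ := fun {f K} hf hK => by
      refine Integrable.of_bound ((continuous_norm.rpow_const fun _ =>
        Or.inr hp0).comp_aestronglyMeasurable hf) (K ^ p) ?_
      filter_upwards [hK] with t ht
      rw [Real.norm_eq_abs, abs_of_nonneg (by positivity)]
      gcongr
    have hdiff : ∀ {f : ℝ → B} {K : ℝ}, AEStronglyMeasurable f μ → (∀ᵐ t ∂μ, ‖f t‖ ≤ K) →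
        Integrable (fun t => ‖f t + w t‖ ^ p - ‖f t‖ ^ p) μ := fun {f K} hf hK => by
      refine (hpow (f := fun t => f t + w t) (K := K + r⁻¹ * (M₃ + ‖z‖)) (hf.add hwm) ?_).sub
        (hpow hf hK)
      filter_upwards [hK, hwR] with t h1 h2
      linarith [norm_add_le (f t) (w t)]
    have hnonneg : 0 ≤ᵐ[μ] fun t => ‖v t + w t‖ ^ p - ‖v t‖ ^ p := by
      refine ae_nonneg_of_forall_setIntegral_nonneg (hdiff hvlimmeas hM₂) fun s hs _ => ?_
      have hset : ∀ f : ℝ → ℝ, ∫ t in s, f t ∂μ = ∫ t, f t * s.indicator (fun _ => 1) t ∂μ :=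
        fun f => by
          rw [← integral_indicator hs]
          congr 1 with t
          by_cases ht : t ∈ s <;> simp [ht]
      have hlim := hconv (s.indicator fun _ => 1)
        (stronglyMeasurable_const.indicator hs).aestronglyMeasurable
        fun t => by by_cases ht : t ∈ s <;> simp [ht]
      simp only [← hset] at hlim
      have hε : ∀ ε > (0 : ℝ), -(ε * μ.real s) ≤ ∫ t in s, (‖v t + w t‖ ^ p - ‖v t‖ ^ p) ∂μ := by
        intro ε hε
        obtain ⟨δ, hδ, hδε⟩ := exists_pos_rpow_sub_rpow_ge (R := M₁) hp0 hε
        obtain ⟨N, hN⟩ := hustrong (r * δ) (mul_pos hr hδ)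
        refine ge_of_tendsto hlim (eventually_atTop.2 ⟨N, fun n hn => ?_⟩)
        have hlow : ∀ᵐ t ∂μ, -ε ≤ ‖vseq (k n) t + w t‖ ^ p - ‖vseq (k n) t‖ ^ p := by
          filter_upwards [hM₁ (k n), hN (k n) (hn.trans (hk.id_le n)), huproj (k n), huC (k n)]
            with t h1 h2 h3 h4
          refine hδε _ _ (norm_nonneg _) h1 (norm_nonneg _) ?_
          have h5 := (mem_projSet_add_smul_iff hr h4).1 h3 z hz
          have h6 : vseq (k n) t + r⁻¹ • (useq (k n) t - z) =
              (vseq (k n) t + w t) + r⁻¹ • (useq (k n) t - u t) := by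
            simp only [w, smul_sub]
            abel
          have h7 : ‖r⁻¹ • (useq (k n) t - u t)‖ ≤ δ := by
            rwa [norm_smul, norm_inv, Real.norm_eq_abs, abs_of_pos hr, inv_mul_le_iff₀ hr]
          rw [h6] at h5
          linarith [norm_add_le (vseq (k n) t + w t) (r⁻¹ • (useq (k n) t - u t))]
        calc -(ε * μ.real s) = ∫ _ in s, -ε ∂μ := by
              rw [setIntegral_const, smul_eq_mul]; ring
          _ ≤ _ := setIntegral_mono_ae (integrable_const (μ := μ) (-ε)).integrableOn
              (hdiff (hvmeas _) (hM₁ _)).integrableOn hlow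
      have hz0 : Tendsto (fun ε : ℝ => -(ε * μ.real s)) (𝓝[>] 0) (𝓝 0) := by
        have : Continuous fun ε : ℝ => -(ε * μ.real s) := by fun_prop
        simpa using (this.tendsto 0).mono_left nhdsWithin_le_nhds
      exact le_of_tendsto hz0 (eventually_mem_nhdsWithin.mono hε)
    filter_upwards [hnonneg] with t ht
    exact (Real.rpow_le_rpow_iff (norm_nonneg _) (norm_nonneg _) (by linarith : 0 < p)).1
      (sub_nonneg.1 ht)
  obtain ⟨D, hDC, hDc, hCD⟩ :=
    (TopologicalSpace.IsSeparable.of_separableSpace C).exists_countable_dense_subset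
  have hD : ∀ᵐ t ∂μ, ∀ z ∈ D, ‖v t‖ ≤ ‖v t + r⁻¹ • (u t - z)‖ :=
    (ae_ball_iff hDc).2 fun z hz => key z (hDC hz)
  filter_upwards [huC', hD] with t htC ht
  refine (mem_projSet_add_smul_iff hr htC).2 fun z hz => ?_
  have hcl : IsClosed {z : B | ‖v t‖ ≤ ‖v t + r⁻¹ • (u t - z)‖} :=
    isClosed_le continuous_const (by fun_prop)
  exact closure_minimal (fun z hz => ht z hz) hcl (hCD hz)
end
end

section
/- Let H be a separable Hilbert space, r > 0, and f : H → H a Lipschitz function with at most linear growth: ‖f(x)‖ ≤ L(1+‖x‖) for all x ∈ H. Let a ∈ H and let C₀ be a nonempty closed subset of H that is (r, f(·+ta) − a)-prox-regular for every t ∈ I, and define C(t) = C₀ + t a for t ∈ I. Then for every u₀ ∈ C₀, the system u̇(t) + N(C(t),u(t)) ∋ f(u(t)), u(0) = u₀, has one and only one absolutely continuous solution u on I = [0,T], and u(t) ∈ C(t) for all t ∈ I. -/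
open MeasureTheory Set Filter Topology

noncomputable section

/-- `Γ^r(C,x) = {v | x ∈ P_C(x + r v)}`, the good directions to project at scale `r`. -/
def gammaSet {E : Type*} [NormedAddCommGroup E] [NormedSpace ℝ E]
    (r : ℝ) (C : Set E) (x : E) : Set E :=
  {v | x ∈ projSet C (x + r • v)}

/-- `C` is `(r,f)`-prox-regular (`r`-prox-regular in the direction `f`): for all `x ∈ C`
and `s ∈ (0,r)`, the projection `z` of `x + s f(x)/‖f(x)‖` onto `C` is well defined
(single valued), and the normalized vector from `z` to `x + s f(x)/‖f(x)‖` belongs to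
`Γ^r(C,z)` (with the convention `v/‖v‖ = 0` when `v = 0`). -/
def DirProxRegular {E : Type*} [NormedAddCommGroup E] [NormedSpace ℝ E]
    (r : ℝ) (f : E → E) (C : Set E) : Prop :=
  ∀ x ∈ C, ∀ s : ℝ, 0 < s → s < r →
    ∃ z : E, projSet C (x + (s * ‖f x‖⁻¹) • f x) = {z} ∧
      ‖x + (s * ‖f x‖⁻¹) • f x - z‖⁻¹ • (x + (s * ‖f x‖⁻¹) • f x - z) ∈ gammaSet r C z

/-- An absolutely continuous solution of the sweeping process
`u̇(t) + N(C(t),u(t)) ∋ f(u(t))`, `u(0) = u₀`, on `[0,T]`: `u` is absolutely continuous,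
i.e. `u(t) = u₀ + ∫₀ᵗ g` for some Bochner-integrable density `g` (`g = u̇` a.e.),
`u(t) ∈ C(t)` for all `t ∈ [0,T]` and `f(u(t)) - u̇(t) ∈ N(C(t),u(t))` a.e. on `[0,T]`. -/
def IsSweepingSol {E : Type*} [NormedAddCommGroup E] [NormedSpace ℝ E] [CompleteSpace E]
    (C : ℝ → Set E) (f : E → E) (T : ℝ) (u₀ : E) (u : ℝ → E) : Prop :=
  ∃ g : ℝ → E, IntegrableOn g (Set.Icc 0 T) ∧
    (∀ t ∈ Set.Icc (0:ℝ) T, u t = u₀ + ∫ s in (0:ℝ)..t, g s) ∧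
    (∀ t ∈ Set.Icc (0:ℝ) T, u t ∈ C t) ∧
    (∀ᵐ t ∂volume.restrict (Set.Icc (0:ℝ) T),
      f (u t) - g t ∈ proxNormalCone (C t) (u t))

/-- A function whose increments are dominated by those of an absolutely continuous function is
absolutely continuous. -/
theorem AbsolutelyContinuousOnInterval.of_dist_le {X Y : Type*} [PseudoMetricSpace X]
    [PseudoMetricSpace Y] {f : ℝ → X} {g : ℝ → Y} {a b : ℝ}
    (hg : AbsolutelyContinuousOnInterval g a b)
    (h : ∀ s ∈ uIcc a b, ∀ t ∈ uIcc a b, dist (f s) (f t) ≤ dist (g s) (g t)) :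
    AbsolutelyContinuousOnInterval f a b := by
  rw [absolutelyContinuousOnInterval_iff] at hg ⊢
  intro ε hε
  obtain ⟨δ, hδ, H⟩ := hg ε hε
  refine ⟨δ, hδ, fun E hE hlt => (Finset.sum_le_sum fun i hi => ?_).trans_lt (H E hE hlt)⟩
  exact h _ (hE.1 i hi).1 _ (hE.1 i hi).2

section

variable {H : Type*} [NormedAddCommGroup H] [InnerProductSpace ℝ H]

/-- The proximal normal cone is described by a quadratic inequality. -/
theorem mem_proxNormalCone_iff {C : Set H} {x v : H} :
    v ∈ proxNormalCone C x ↔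
      x ∈ C ∧ ∃ A : ℝ, ∀ y ∈ C, inner ℝ v (y - x) ≤ A * ‖y - x‖ ^ 2 := by
  have expand : ∀ (s : ℝ) (y : H), ‖x + s • v - y‖ ^ 2 =
      ‖s • v‖ ^ 2 - 2 * (s * inner ℝ v (y - x)) + ‖y - x‖ ^ 2 := fun s y => by
    rw [show x + s • v - y = s • v - (y - x) by abel, norm_sub_sq_real, real_inner_smul_left]
  constructor
  · rintro ⟨s, hs, hx, hd⟩
    refine ⟨hx, 1 / (2 * s), fun y hy => ?_⟩
    have h1 : ‖x + s • v - x‖ ≤ ‖x + s • v - y‖ := by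
      rw [hd, ← dist_eq_norm]; exact Metric.infDist_le_dist_of_mem hy
    have h2 := pow_le_pow_left₀ (norm_nonneg _) h1 2
    rw [expand, expand, sub_self, inner_zero_right, norm_zero] at h2
    rw [div_mul_eq_mul_div, le_div_iff₀ (by positivity)]
    linarith
  · rintro ⟨hx, A, hA⟩
    have hs : 0 < 1 / (2 * (|A| + 1)) := by positivity
    refine ⟨_, hs, hx, ?_⟩
    set s := 1 / (2 * (|A| + 1)) with hsdef
    refine le_antisymm ((Metric.le_infDist ⟨x, hx⟩).2 fun y hy => ?_) ?_
    · rw [dist_eq_norm]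
      refine le_of_sq_le_sq ?_ (norm_nonneg _)
      rw [expand, expand, sub_self, inner_zero_right, norm_zero]
      have h1 : s * inner ℝ v (y - x) ≤ s * ((|A| + 1) * ‖y - x‖ ^ 2) := by
        refine mul_le_mul_of_nonneg_left ((hA y hy).trans ?_) hs.le
        gcongr
        linarith [le_abs_self A]
      have h2 : s * ((|A| + 1) * ‖y - x‖ ^ 2) = ‖y - x‖ ^ 2 / 2 := by
        rw [hsdef]; field_simp
      linarith
    · rw [← dist_eq_norm]; exact Metric.infDist_le_dist_of_mem hx

/-- One projection step in a directionally prox-regular set: the residual `q` of the projection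
of `x + h f(x)` has minimal norm and is a proximal normal direction at scale `r`. -/
theorem DirProxRegular.exists_residual {C : Set H} {f : H → H} {r : ℝ}
    (hC : DirProxRegular r f C) (hr : 0 < r) {x : H} (hx : x ∈ C) {h : ℝ} (hh : 0 < h)
    (hlt : h * ‖f x‖ < r) :
    ∃ q : H, x + h • (f x - q) ∈ C ∧ (∀ y ∈ C, h * ‖q‖ ≤ ‖x + h • f x - y‖) ∧
      ∀ y ∈ C, inner ℝ q (y - (x + h • (f x - q))) ≤
        ‖q‖ / (2 * r) * ‖y - (x + h • (f x - q))‖ ^ 2 := by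
  by_cases hf : f x = 0
  · exact ⟨0, by simpa [hf] using hx, by simp, by simp⟩
  have hn : 0 < ‖f x‖ := norm_pos_iff.2 hf
  obtain ⟨z, hz, hzr⟩ := hC x hx (h * ‖f x‖) (by positivity) hlt
  rw [mul_assoc, mul_inv_cancel₀ hn.ne', mul_one] at hz hzr
  have hzm : z ∈ projSet C (x + h • f x) := hz ▸ mem_singleton z
  obtain ⟨hzC, hzd⟩ := hzm
  obtain ⟨q, hhq⟩ : ∃ q : H, h • q = x + h • f x - z :=
    ⟨h⁻¹ • (x + h • f x - z), smul_inv_smul₀ hh.ne' _⟩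
  have hxz : x + h • (f x - q) = z := by rw [smul_sub, hhq]; abel
  have hnq : h * ‖q‖ = ‖x + h • f x - z‖ := by
    rw [← hhq, norm_smul, Real.norm_of_nonneg hh.le]
  refine ⟨q, hxz ▸ hzC, fun y hy => ?_, fun y hy => ?_⟩
  · rw [hnq, hzd, ← dist_eq_norm]; exact Metric.infDist_le_dist_of_mem hy
  rw [hxz]
  by_cases hq0 : q = 0
  · simp [hq0]
  have hqn : 0 < ‖q‖ := norm_pos_iff.2 hq0
  rw [← hhq, norm_smul, Real.norm_of_nonneg hh.le, smul_smul,
    show (h * ‖q‖)⁻¹ * h = ‖q‖⁻¹ by field_simp] at hzr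
  have h1 : ‖z + r • ‖q‖⁻¹ • q - z‖ ≤ ‖z + r • ‖q‖⁻¹ • q - y‖ := by
    rw [hzr.2, ← dist_eq_norm]; exact Metric.infDist_le_dist_of_mem hy
  have h2 := pow_le_pow_left₀ (norm_nonneg _) h1 2
  rw [add_sub_cancel_left, show z + r • ‖q‖⁻¹ • q - y = r • ‖q‖⁻¹ • q - (y - z) by abel,
    norm_sub_sq_real, smul_smul, real_inner_smul_left] at h2
  have h3 : 2 * (r * ‖q‖⁻¹ * inner ℝ q (y - z)) ≤ ‖y - z‖ ^ 2 := by linarith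
  have h4 : inner ℝ q (y - z) = ‖q‖ / (2 * r) * (2 * (r * ‖q‖⁻¹ * inner ℝ q (y - z))) := by
    field_simp
  rw [h4]
  gcongr

/-- Along a curve in `C`, a proximal normal is orthogonal to the velocity. -/
theorem inner_velocity_eq_zero {C : Set H} {w : ℝ → H} {t A : ℝ} {g v : H}
    (hw : HasDerivAt w g t) (hwC : ∀ᶠ s in 𝓝 t, w s ∈ C)
    (hv : ∀ y ∈ C, inner ℝ v (y - w t) ≤ A * ‖y - w t‖ ^ 2) : inner ℝ v g = 0 := by
  have hd : HasDerivAt (fun s => w s - w t) g t := hw.sub_const _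
  have h1 : HasDerivAt (fun s => inner ℝ v (w s - w t) - A * ‖w s - w t‖ ^ 2)
      (inner ℝ v g) t := by
    have := ((hasDerivAt_const t v).inner ℝ hd).fun_sub (hd.norm_sq.const_mul A)
    simpa using this
  refine IsLocalMax.hasDerivAt_eq_zero (f := fun s => inner ℝ v (w s - w t) -
    A * ‖w s - w t‖ ^ 2) ?_ h1
  filter_upwards [hwC] with s hs
  simpa using hv _ hs

/-- In a directionally prox-regular set, the proximal normal `f(w(t)) - ẇ(t)` of a curve staying in
the set is a proximal normal direction at the uniform scale `r`. -/
theorem DirProxRegular.inner_le_of_hasDerivAt {C : Set H} {f : H → H} {r : ℝ}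
    (hC : DirProxRegular r f C) (hr : 0 < r) {w : ℝ → H} {t : ℝ} {g : H}
    (hw : HasDerivAt w g t) (hwC : ∀ᶠ s in 𝓝 t, w s ∈ C)
    (hv : f (w t) - g ∈ proxNormalCone C (w t)) :
    inner ℝ (f (w t) - g) g = 0 ∧ ∀ y ∈ C, inner ℝ (f (w t) - g) (y - w t) ≤
      ‖f (w t) - g‖ / (2 * r) * ‖y - w t‖ ^ 2 := by
  obtain ⟨hx, A, hA⟩ := mem_proxNormalCone_iff.1 hv
  set x := w t with hxdef
  set v := f x - g with hvdef
  have horth : inner ℝ v g = 0 := inner_velocity_eq_zero hw hwC hA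
  refine ⟨horth, fun y hy => ?_⟩
  have hvf : inner ℝ v (f x) = ‖v‖ ^ 2 := by
    rw [show f x = v + g by rw [hvdef]; abel, inner_add_right, horth, add_zero,
      real_inner_self_eq_norm_sq]
  have hsmall : ∀ᶠ h : ℝ in 𝓝[>] 0, 0 < h ∧ h * ‖f x‖ < r := by
    refine Eventually.and self_mem_nhdsWithin (Filter.Eventually.filter_mono nhdsWithin_le_nhds ?_)
    have : Tendsto (fun h : ℝ => h * ‖f x‖) (𝓝 0) (𝓝 (0 * ‖f x‖)) :=
      tendsto_id.mul_const _
    rw [zero_mul] at this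
    exact this.eventually_lt_const hr
  have hres : ∀ h : ℝ, 0 < h ∧ h * ‖f x‖ < r → _ := fun h hh =>
    hC.exists_residual hr hx hh.1 hh.2
  choose! q hqC hqmin hqn using hres
  have htend0 : Tendsto (fun h : ℝ => h) (𝓝[>] 0) (𝓝 0) := nhdsWithin_le_nhds
  have hslope : Tendsto (fun h : ℝ => h⁻¹ • (w (t + h) - w t)) (𝓝[>] 0) (𝓝 g) :=
    hw.tendsto_slope_zero_right
  have hwnear : ∀ᶠ h : ℝ in 𝓝[>] 0, w (t + h) ∈ C := by
    have : Tendsto (fun h : ℝ => t + h) (𝓝[>] 0) (𝓝 t) := by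
      simpa using htend0.const_add t
    exact this.eventually hwC
  have hqle : ∀ᶠ h : ℝ in 𝓝[>] 0, ‖q h‖ ≤ ‖f x - h⁻¹ • (w (t + h) - w t)‖ := by
    filter_upwards [hsmall, hwnear] with h hh hwh
    have h1 := hqmin h hh _ hwh
    have h2 : x + h • f x - w (t + h) = h • (f x - h⁻¹ • (w (t + h) - w t)) := by
      rw [smul_sub, smul_inv_smul₀ hh.1.ne']; abel
    rw [h2, norm_smul, Real.norm_of_nonneg hh.1.le] at h1
    exact le_of_mul_le_mul_left h1 hh.1
  have hqv : ∀ᶠ h : ℝ in 𝓝[>] 0, ‖q h - v‖ ^ 2 ≤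
      ‖f x - h⁻¹ • (w (t + h) - w t)‖ ^ 2 - ‖v‖ ^ 2 + 8 * |A| * h * ‖f x‖ ^ 2 := by
    filter_upwards [hsmall, hqle] with h hh hle
    have hqf : ‖q h‖ ≤ ‖f x‖ := by
      have := hqmin h hh x hx
      rw [add_sub_cancel_left, norm_smul, Real.norm_of_nonneg hh.1.le] at this
      exact le_of_mul_le_mul_left this hh.1
    have h1 := hA _ (hqC h hh)
    rw [add_sub_cancel_left, real_inner_smul_right, norm_smul, Real.norm_of_nonneg hh.1.le,
      inner_sub_right, hvf] at h1
    have h2 : ‖f x - q h‖ ^ 2 ≤ (2 * ‖f x‖) ^ 2 := by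
      gcongr
      linarith [norm_sub_le (f x) (q h)]
    have h3 : A * (h * ‖f x - q h‖) ^ 2 ≤ h * (|A| * h * (2 * ‖f x‖) ^ 2) := by
      calc A * (h * ‖f x - q h‖) ^ 2 ≤ |A| * (h * ‖f x - q h‖) ^ 2 := by
            gcongr; exact le_abs_self A
        _ = h * (|A| * h * ‖f x - q h‖ ^ 2) := by ring
        _ ≤ _ := by
            have := hh.1
            gcongr
    have h4 := le_of_mul_le_mul_left (h1.trans h3) hh.1
    have h5 := pow_le_pow_left₀ (norm_nonneg _) hle 2
    rw [norm_sub_sq_real, real_inner_comm]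
    nlinarith
  have hqt : Tendsto q (𝓝[>] 0) (𝓝 v) := by
    rw [tendsto_iff_norm_sub_tendsto_zero]
    have h1 : Tendsto (fun h : ℝ => ‖f x - h⁻¹ • (w (t + h) - w t)‖ ^ 2 - ‖v‖ ^ 2 +
        8 * |A| * h * ‖f x‖ ^ 2) (𝓝[>] 0) (𝓝 (‖f x - g‖ ^ 2 - ‖v‖ ^ 2 +
        8 * |A| * 0 * ‖f x‖ ^ 2)) :=
      (((hslope.const_sub (f x)).norm.pow 2).sub_const _).add
        ((htend0.const_mul _).mul_const _)
    rw [← hvdef, sub_self, mul_zero, zero_mul, zero_add] at h1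
    have h2 : Tendsto (fun h => ‖q h - v‖ ^ 2) (𝓝[>] 0) (𝓝 0) :=
      squeeze_zero' (Eventually.of_forall fun _ => by positivity) hqv h1
    simpa using h2.sqrt
  have hzt : Tendsto (fun h : ℝ => y - (x + h • (f x - q h))) (𝓝[>] 0) (𝓝 (y - x)) := by
    have := ((htend0.smul (hqt.const_sub (f x))).const_add x).const_sub y
    simpa using this
  refine le_of_tendsto_of_tendsto (hqt.inner hzt)
    ((hqt.norm.div_const _).mul (hzt.norm.pow 2)) ?_
  filter_upwards [hsmall] with h hh using hqn h hh y hy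
/-- A differential form of Gronwall's inequality for the squared norm of a primitive. -/
theorem norm_sq_integral_le_of_inner_le [CompleteSpace H] {T A B : ℝ} {g : ℝ → H}
    (hg : IntegrableOn g (Icc 0 T)) (hA : 0 ≤ A) (hB : 0 ≤ B)
    (h : ∀ᵐ t ∂volume.restrict (Icc (0 : ℝ) T),
      inner ℝ (g t) (∫ s in (0 : ℝ)..t, g s) ≤ A * ‖∫ s in (0 : ℝ)..t, g s‖ ^ 2 + B)
    {t : ℝ} (ht : t ∈ Icc (0 : ℝ) T) :
    ‖∫ s in (0 : ℝ)..t, g s‖ ^ 2 ≤ 2 * B * T * Real.exp (2 * A * T) := by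
  have ht0 := ht.1
  have hT : 0 ≤ T := ht0.trans ht.2
  set δ : ℝ → H := fun t => ∫ s in (0 : ℝ)..t, g s with hδ
  have hgt : IntervalIntegrable g volume 0 t :=
    (intervalIntegrable_iff_integrableOn_Icc_of_le ht0).2
      (hg.mono_set (Icc_subset_Icc_right ht.2))
  have hint : ∀ s ∈ uIcc 0 t, IntervalIntegrable g volume 0 s := fun s hs =>
    hgt.mono_set (uIcc_subset_uIcc_left hs)
  have hδac : AbsolutelyContinuousOnInterval (fun s => ‖δ s‖) 0 t := by
    refine (hgt.norm.absolutelyContinuousOnInterval_intervalIntegral left_mem_uIcc).of_dist_le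
      fun a ha b hb => ?_
    rw [dist_comm, dist_comm (∫ v in (0 : ℝ)..a, ‖g v‖), Real.dist_eq, Real.dist_eq,
      intervalIntegral.integral_interval_sub_left (hint b hb).norm (hint a ha).norm]
    refine (abs_norm_sub_norm_le _ _).trans ?_
    rw [hδ, intervalIntegral.integral_interval_sub_left (hint b hb) (hint a ha)]
    exact intervalIntegral.norm_integral_le_abs_integral_norm
  have hexp : AbsolutelyContinuousOnInterval (fun s : ℝ => Real.exp (-(2 * A) * s)) 0 t :=
    ContDiffOn.absolutelyContinuousOnInterval (by fun_prop)
  have hac := hexp.mul (hδac.mul hδac)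
  have hftc := hac.integral_deriv_eq_sub
  have hderiv : ∀ᵐ s, s ∈ Icc 0 t →
      deriv ((fun s : ℝ => Real.exp (-(2 * A) * s)) * ((fun s => ‖δ s‖) * fun s => ‖δ s‖)) s
        ≤ 2 * B := by
    filter_upwards [hgt.ae_hasDerivAt_integral, (ae_restrict_iff' measurableSet_Icc).1 h]
      with s hs1 hs2 hs
    have hd : HasDerivAt δ (g s) s := hs1 (by rwa [uIcc_of_le ht0]) 0 left_mem_uIcc
    have he : HasDerivAt (fun s : ℝ => Real.exp (-(2 * A) * s))
        (Real.exp (-(2 * A) * s) * (-(2 * A))) s := by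
      simpa using ((hasDerivAt_id s).const_mul (-(2 * A))).exp
    have hp := he.mul hd.norm_sq
    have hfun : ((fun s : ℝ => Real.exp (-(2 * A) * s)) * ((fun s => ‖δ s‖) * fun s => ‖δ s‖)) =
        (fun s : ℝ => Real.exp (-(2 * A) * s)) * fun s => ‖δ s‖ ^ 2 := by
      ext s; simp [sq]
    rw [hfun, hp.deriv]
    have h3 := hs2 ⟨hs.1, hs.2.trans ht.2⟩
    rw [real_inner_comm] at h3
    have h4 : Real.exp (-(2 * A) * s) ≤ 1 := by
      rw [Real.exp_le_one_iff]; nlinarith [hs.1, mul_nonneg hA hs.1]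
    calc Real.exp (-(2 * A) * s) * -(2 * A) * ‖δ s‖ ^ 2 +
          Real.exp (-(2 * A) * s) * (2 * inner ℝ (δ s) (g s))
        = 2 * Real.exp (-(2 * A) * s) * (inner ℝ (δ s) (g s) - A * ‖δ s‖ ^ 2) := by ring
      _ ≤ 2 * Real.exp (-(2 * A) * s) * B := by
          gcongr
          linarith
      _ ≤ 2 * 1 * B := by gcongr
      _ = 2 * B := by ring
  have hle : Real.exp (-(2 * A) * t) * ‖δ t‖ ^ 2 ≤ 2 * B * t := by
    calc Real.exp (-(2 * A) * t) * ‖δ t‖ ^ 2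
        = ∫ s in (0 : ℝ)..t, deriv ((fun s : ℝ => Real.exp (-(2 * A) * s)) *
            ((fun s => ‖δ s‖) * fun s => ‖δ s‖)) s := by
          rw [hftc]; simp [hδ, sq]
      _ ≤ ∫ _ in (0 : ℝ)..t, 2 * B :=
          intervalIntegral.integral_mono_ae_restrict ht0 hac.intervalIntegrable_deriv
            intervalIntegrable_const ((ae_restrict_iff' measurableSet_Icc).2 hderiv)
      _ = 2 * B * t := by simp; ring
  calc ‖δ t‖ ^ 2 = Real.exp (-(2 * A) * t) * ‖δ t‖ ^ 2 * Real.exp (2 * A * t) := by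
        rw [mul_right_comm, ← Real.exp_add]; simp
    _ ≤ 2 * B * t * Real.exp (2 * A * t) := by gcongr
    _ ≤ 2 * B * T * Real.exp (2 * A * T) := by
        have := ht.2
        gcongr

/-- A bounded sequence in a Hilbert space converges weakly along every ultrafilter. -/
theorem exists_tendsto_inner_of_norm_le {E ι : Type*} [NormedAddCommGroup E]
    [InnerProductSpace ℝ E] [CompleteSpace E] (U : Ultrafilter ι) {x : ι → E} {M : ℝ}
    (hx : ∀ i, ‖x i‖ ≤ M) :
    ∃ y : E, ∀ φ : E, Tendsto (fun i => inner ℝ (x i) φ) U (𝓝 (inner ℝ y φ)) := by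
  have hc := WeakDual.isCompact_closedBall (𝕜 := ℝ) (0 : StrongDual ℝ E) M
  let T : ι → WeakDual ℝ E := fun i =>
    StrongDual.toWeakDual (InnerProductSpace.toDual ℝ E (x i))
  obtain ⟨l, -, hl⟩ := hc.ultrafilter_le_nhds (U.map T) (by
    rw [Ultrafilter.coe_map, le_principal_iff, mem_map]
    refine univ_mem' fun i => ?_
    simpa [T] using hx i)
  refine ⟨(InnerProductSpace.toDual ℝ E).symm (WeakDual.toStrongDual l), fun φ => ?_⟩
  have h1 : Tendsto T U (𝓝 l) := hl
  have h2 := ((WeakDual.eval_continuous φ).tendsto l).comp h1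
  rw [InnerProductSpace.toDual_symm_apply]
  exact h2

/-- Weak sequential compactness of uniformly bounded functions, tested against
square-integrable functions. -/
theorem exists_tendsto_integral_inner_of_norm_le [CompleteSpace H] {α ι : Type*}
    [MeasurableSpace α] {μ : Measure α} [IsFiniteMeasure μ] (U : Ultrafilter ι)
    {g : ι → α → H} {M : ℝ} (hgm : ∀ i, AEStronglyMeasurable (g i) μ)
    (hgM : ∀ i, ∀ᵐ t ∂μ, ‖g i t‖ ≤ M) :
    ∃ G : α → H, MemLp G 2 μ ∧ ∀ φ : α → H, MemLp φ 2 μ →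
      Tendsto (fun i => ∫ t, inner ℝ (g i t) (φ t) ∂μ) U (𝓝 (∫ t, inner ℝ (G t) (φ t) ∂μ)) := by
  have hmem : ∀ i, MemLp (g i) 2 μ := fun i => MemLp.of_bound (hgm i) M (hgM i)
  have key : ∀ {a b : α → H} (ha : MemLp a 2 μ) (hb : MemLp b 2 μ),
      inner ℝ (ha.toLp a) (hb.toLp b) = ∫ t, inner ℝ (a t) (b t) ∂μ := fun ha hb => by
    rw [L2.inner_def]
    refine integral_congr_ae ?_
    filter_upwards [ha.coeFn_toLp, hb.coeFn_toLp] with t h1 h2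
    rw [h1, h2]
  have hbound : ∀ i, ‖(hmem i).toLp (g i)‖ ≤ μ.real univ ^ (2 : ENNReal).toReal⁻¹ * |M| :=
    fun i => by
    refine Lp.norm_le_of_ae_bound (abs_nonneg M) ?_
    filter_upwards [(hmem i).coeFn_toLp, hgM i] with t h1 h2
    rw [h1]
    exact h2.trans (le_abs_self M)
  obtain ⟨G, hG⟩ := exists_tendsto_inner_of_norm_le U hbound
  refine ⟨G, Lp.memLp G, fun φ hφ => ?_⟩
  have h1 := hG (hφ.toLp φ)
  simp only [key] at h1
  convert h1 using 2
  rw [← key (Lp.memLp G) hφ, Lp.toLp_coeFn]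
/-- Two pairs of positions and velocities whose residuals are approximate proximal normals satisfy
a one-sided Lipschitz estimate. -/
theorem inner_sub_le_of_approx_normal {C : Set H} {x₁ x₂ p₁ p₂ f₁ f₂ g₁ g₂ : H}
    {A M K ε₁ ε₂ : ℝ} (hA : 0 ≤ A) (hε : ε₁ + ε₂ ≤ 1) (hp₁ : p₁ ∈ C) (hp₂ : p₂ ∈ C)
    (hf : ‖f₁ - f₂‖ ≤ K * ‖x₁ - x₂‖) (hx₁ : ‖x₁ - p₁‖ ≤ ε₁) (hx₂ : ‖x₂ - p₂‖ ≤ ε₂)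
    (hM₁ : ‖f₁ - g₁‖ ≤ M) (hM₂ : ‖f₂ - g₂‖ ≤ M)
    (hn₁ : ∀ y ∈ C, inner ℝ (f₁ - g₁) (y - p₁) ≤ A * ‖y - p₁‖ ^ 2 + ε₁ * ‖y - p₁‖)
    (hn₂ : ∀ y ∈ C, inner ℝ (f₂ - g₂) (y - p₂) ≤ A * ‖y - p₂‖ ^ 2 + ε₂ * ‖y - p₂‖) :
    inner ℝ (g₁ - g₂) (x₁ - x₂) ≤
      (K + 4 * A + 1) * ‖x₁ - x₂‖ ^ 2 + (4 * A + 2 + 2 * M) * (ε₁ + ε₂) := by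
  have hε₁ : 0 ≤ ε₁ := (norm_nonneg _).trans hx₁
  have hε₂ : 0 ≤ ε₂ := (norm_nonneg _).trans hx₂
  have hM : 0 ≤ M := (norm_nonneg _).trans hM₁
  have hsplit : inner ℝ (g₁ - g₂) (x₁ - x₂) = inner ℝ (f₁ - f₂) (x₁ - x₂) +
      inner ℝ (f₁ - g₁) (p₂ - p₁) + inner ℝ (f₂ - g₂) (p₁ - p₂) -
      inner ℝ ((f₁ - g₁) - (f₂ - g₂)) ((x₁ - p₁) - (x₂ - p₂)) := by
    simp only [inner_sub_left, inner_sub_right]; ring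
  have h1 : inner ℝ (f₁ - f₂) (x₁ - x₂) ≤ K * ‖x₁ - x₂‖ ^ 2 := by
    refine (real_inner_le_norm _ _).trans ?_
    rw [sq, ← mul_assoc]
    gcongr
  have h2 : -inner ℝ ((f₁ - g₁) - (f₂ - g₂)) ((x₁ - p₁) - (x₂ - p₂)) ≤
      (M + M) * (ε₁ + ε₂) := by
    rw [← inner_neg_left]
    refine (real_inner_le_norm _ _).trans ?_
    rw [norm_neg]
    gcongr
    · exact (norm_sub_le _ _).trans (add_le_add hM₁ hM₂)
    · exact (norm_sub_le _ _).trans (add_le_add hx₁ hx₂)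
  have h3 := hn₁ p₂ hp₂
  have h4 := hn₂ p₁ hp₁
  rw [norm_sub_rev p₂ p₁] at h3
  have hd : ‖p₁ - p₂‖ ≤ ‖x₁ - x₂‖ + (ε₁ + ε₂) := by
    calc ‖p₁ - p₂‖ = ‖(x₁ - x₂) - ((x₁ - p₁) - (x₂ - p₂))‖ := by congr 1; abel
      _ ≤ ‖x₁ - x₂‖ + (‖x₁ - p₁‖ + ‖x₂ - p₂‖) :=
          (norm_sub_le _ _).trans (by gcongr; exact norm_sub_le _ _)
      _ ≤ _ := by gcongr
  set d := ‖x₁ - x₂‖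
  set η := ε₁ + ε₂ with hη
  have hd0 : 0 ≤ d := norm_nonneg _
  have hη0 : 0 ≤ η := by positivity
  have hηη : η ^ 2 ≤ η := by nlinarith
  have h5 : ‖p₁ - p₂‖ ^ 2 ≤ 2 * d ^ 2 + 2 * η := by
    have := pow_le_pow_left₀ (norm_nonneg _) hd 2
    nlinarith [sq_nonneg (d - η)]
  have h6 : η * ‖p₁ - p₂‖ ≤ d ^ 2 + 2 * η := by
    have := mul_le_mul_of_nonneg_left hd hη0
    nlinarith [sq_nonneg (d - η)]
  have h7 := mul_le_mul_of_nonneg_left h5 hA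
  rw [hsplit]
  nlinarith

/-- `g` is the velocity of an approximate solution `w = w₀ + ∫ g` of the perturbed sweeping process
`ẇ + N(C, w) ∋ F(t, w)`, shadowed by the function `p` with values in `C`, with error `ε`. -/
structure IsApproxSol (F : ℝ → H → H) (C : Set H) (T : ℝ) (w₀ : H) (A M ε : ℝ)
    (g p : ℝ → H) : Prop where
  integrableOn : IntegrableOn g (Icc 0 T)
  mem : ∀ t ∈ Icc (0 : ℝ) T, p t ∈ C
  norm_sub_le : ∀ t ∈ Icc (0 : ℝ) T, ‖(w₀ + ∫ s in (0 : ℝ)..t, g s) - p t‖ ≤ ε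
  norm_velocity_le : ∀ᵐ t ∂volume.restrict (Icc (0 : ℝ) T), ‖g t‖ ≤ M
  norm_residual_le : ∀ᵐ t ∂volume.restrict (Icc (0 : ℝ) T),
    ‖F t (w₀ + ∫ s in (0 : ℝ)..t, g s) - g t‖ ≤ M
  inner_le : ∀ᵐ t ∂volume.restrict (Icc (0 : ℝ) T), ∀ y ∈ C,
    inner ℝ (F t (w₀ + ∫ s in (0 : ℝ)..t, g s) - g t) (y - p t) ≤
      A * ‖y - p t‖ ^ 2 + ε * ‖y - p t‖

/-- Two approximate solutions with the same initial value are close. -/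
theorem IsApproxSol.norm_sub_sq_le [CompleteSpace H] {F : ℝ → H → H} {K : NNReal} {C : Set H}
    {T : ℝ} {w₀ : H} {A M ε₁ ε₂ : ℝ} {g₁ g₂ p₁ p₂ : ℝ → H}
    (hF : ∀ t x y, ‖F t x - F t y‖ ≤ K * ‖x - y‖) (hA : 0 ≤ A) (hM : 0 ≤ M)
    (hε : ε₁ + ε₂ ≤ 1) (h₁ : IsApproxSol F C T w₀ A M ε₁ g₁ p₁)
    (h₂ : IsApproxSol F C T w₀ A M ε₂ g₂ p₂) {t : ℝ} (ht : t ∈ Icc (0 : ℝ) T) :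
    ‖(w₀ + ∫ s in (0 : ℝ)..t, g₁ s) - (w₀ + ∫ s in (0 : ℝ)..t, g₂ s)‖ ^ 2 ≤
      2 * (4 * A + 2 + 2 * M) * T * Real.exp (2 * (K + 4 * A + 1) * T) * (ε₁ + ε₂) := by
  have hint : ∀ {g : ℝ → H}, IntegrableOn g (Icc 0 T) → ∀ t ∈ Icc (0 : ℝ) T,
      IntervalIntegrable g volume 0 t := fun hg t ht =>
    (intervalIntegrable_iff_integrableOn_Icc_of_le ht.1).2
      (hg.mono_set (Icc_subset_Icc_right ht.2))
  have hsub : ∀ t ∈ Icc (0 : ℝ) T, ∫ s in (0 : ℝ)..t, (g₁ - g₂) s =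
      (w₀ + ∫ s in (0 : ℝ)..t, g₁ s) - (w₀ + ∫ s in (0 : ℝ)..t, g₂ s) := fun t ht => by
    rw [add_sub_add_left_eq_sub]
    exact intervalIntegral.integral_sub (hint h₁.integrableOn t ht) (hint h₂.integrableOn t ht)
  have hε₁ : 0 ≤ ε₁ := (norm_nonneg _).trans (h₁.norm_sub_le t ht)
  have hε₂ : 0 ≤ ε₂ := (norm_nonneg _).trans (h₂.norm_sub_le t ht)
  have h := norm_sq_integral_le_of_inner_le (h₁.integrableOn.sub h₂.integrableOn)
    (A := K + 4 * A + 1) (B := (4 * A + 2 + 2 * M) * (ε₁ + ε₂)) (by positivity) (by positivity)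
    (by
      filter_upwards [h₁.norm_residual_le, h₂.norm_residual_le, h₁.inner_le, h₂.inner_le,
        ae_restrict_mem measurableSet_Icc] with t hm₁ hm₂ hn₁ hn₂ ht
      rw [hsub t ht]
      exact inner_sub_le_of_approx_normal hA hε (h₁.mem t ht) (h₂.mem t ht) (hF t _ _)
        (h₁.norm_sub_le t ht) (h₂.norm_sub_le t ht) hm₁ hm₂ hn₁ hn₂) ht
  rw [hsub t ht] at h
  exact h.trans (le_of_eq (by ring))

theorem continuousOn_primitive_add [CompleteSpace H] {T : ℝ} {g : ℝ → H} (w₀ : H)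
    (hg : IntegrableOn g (Icc 0 T)) :
    ContinuousOn (fun t => w₀ + ∫ s in (0 : ℝ)..t, g s) (Icc 0 T) := by
  rcases le_or_gt 0 T with hT | hT
  · rw [← uIcc_of_le hT] at hg ⊢
    exact continuousOn_const.add (intervalIntegral.continuousOn_primitive_interval hg)
  · simp [Icc_eq_empty_of_lt hT]

theorem continuousOn_field_comp {E : Type*} [NormedAddCommGroup E] {F : ℝ → E → E} {K D : NNReal}
    (hF : ∀ s t x y, ‖F s x - F t y‖ ≤ D * |s - t| + K * ‖x - y‖) {w : ℝ → E} {S : Set ℝ}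
    (hw : ContinuousOn w S) : ContinuousOn (fun t => F t (w t)) S := by
  have hlip : LipschitzWith (D + K) (fun z : ℝ × E => F z.1 z.2) := by
    refine LipschitzWith.of_dist_le_mul fun z z' => ?_
    rw [dist_eq_norm, NNReal.coe_add, add_mul]
    refine (hF _ _ _ _).trans ?_
    rw [← Real.dist_eq, ← dist_eq_norm, Prod.dist_eq]
    gcongr
    · exact le_max_left _ _
    · exact le_max_right _ _
  exact hlip.continuous.comp_continuousOn (continuousOn_id.prodMk hw)

/-- Exact solutions are approximate solutions with zero error and a uniform normal constant. -/
theorem exists_isApproxSol_zero [CompleteSpace H] {F : ℝ → H → H} {K D : NNReal} {C : Set H}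
    {T r : ℝ} {w₀ : H} {g : ℝ → H} (hr : 0 < r)
    (hF : ∀ s t x y, ‖F s x - F t y‖ ≤ D * |s - t| + K * ‖x - y‖)
    (hC : ∀ t ∈ Icc (0 : ℝ) T, DirProxRegular r (F t) C) (hg : IntegrableOn g (Icc 0 T))
    (hmem : ∀ t ∈ Icc (0 : ℝ) T, w₀ + ∫ s in (0 : ℝ)..t, g s ∈ C)
    (hnormal : ∀ᵐ t ∂volume.restrict (Icc (0 : ℝ) T),
      F t (w₀ + ∫ s in (0 : ℝ)..t, g s) - g t ∈
        proxNormalCone C (w₀ + ∫ s in (0 : ℝ)..t, g s)) :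
    ∃ M : ℝ, ∀ M' ≥ M, IsApproxSol F C T w₀ (M' / (2 * r)) M' 0 g
      (fun t => w₀ + ∫ s in (0 : ℝ)..t, g s) := by
  set w : ℝ → H := fun t => w₀ + ∫ s in (0 : ℝ)..t, g s with hw
  obtain ⟨M, hM⟩ := isCompact_Icc.exists_bound_of_continuousOn
    (continuousOn_field_comp hF (continuousOn_primitive_add w₀ hg))
  have key : ∀ᵐ t ∂volume.restrict (Icc (0 : ℝ) T), inner ℝ (F t (w t) - g t) (g t) = 0 ∧
      ∀ y ∈ C, inner ℝ (F t (w t) - g t) (y - w t) ≤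
        ‖F t (w t) - g t‖ / (2 * r) * ‖y - w t‖ ^ 2 := by
    rw [← Measure.restrict_congr_set Ioo_ae_eq_Icc] at hnormal ⊢
    rcases le_or_gt T 0 with hT | hT
    · simp [Ioo_eq_empty_of_le hT]
    have hgi : IntervalIntegrable g volume 0 T :=
      (intervalIntegrable_iff_integrableOn_Icc_of_le hT.le).2 hg
    filter_upwards [hnormal, ae_restrict_mem measurableSet_Ioo,
      ae_restrict_of_ae hgi.ae_hasDerivAt_integral] with t hn ht hd
    have hd' : HasDerivAt w (g t) t := (hd (by
      rw [uIcc_of_le hT.le]; exact Ioo_subset_Icc_self ht) 0 left_mem_uIcc).const_add w₀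
    refine (hC t (Ioo_subset_Icc_self ht)).inner_le_of_hasDerivAt hr hd' ?_ hn
    filter_upwards [Icc_mem_nhds ht.1 ht.2] with s hs using hmem s hs
  have hbound : ∀ᵐ t ∂volume.restrict (Icc (0 : ℝ) T), ‖g t‖ ≤ M ∧ ‖F t (w t) - g t‖ ≤ M := by
    filter_upwards [key, ae_restrict_mem measurableSet_Icc] with t hk ht
    have h1 := norm_add_sq_real (F t (w t) - g t) (g t)
    rw [hk.1, sub_add_cancel] at h1
    have h2 := hM t ht
    constructor
    · refine le_trans (le_of_sq_le_sq ?_ (norm_nonneg _)) h2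
      nlinarith [sq_nonneg ‖F t (w t) - g t‖]
    · refine le_trans (le_of_sq_le_sq ?_ (norm_nonneg _)) h2
      nlinarith [sq_nonneg ‖g t‖]
  refine ⟨M, fun M' hM' => ⟨hg, hmem, fun t _ => by simp [hw], ?_, ?_, ?_⟩⟩
  · filter_upwards [hbound] with t h using h.1.trans hM'
  · filter_upwards [hbound] with t h using h.2.trans hM'
  · filter_upwards [hbound, key] with t h hk y hy
    rw [zero_mul, add_zero]
    refine (hk.2 y hy).trans ?_
    gcongr
    exact h.2.trans hM'
theorem integrableOn_comp_floor {E : Type*} [NormedAddCommGroup E] (h : ℝ) (G : ℕ → E) (R : ℝ)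
    (hh : 0 < h) : IntegrableOn (fun t : ℝ => G ⌊t / h⌋₊) (Icc 0 R) := by
  have hm : StronglyMeasurable (fun t : ℝ => G ⌊t / h⌋₊) :=
    (StronglyMeasurable.of_discrete (f := G)).comp_measurable
      (Nat.measurable_floor.comp (measurable_id.div_const h))
  refine Measure.integrableOn_of_bounded (M := ∑ i ∈ Finset.range (⌊R / h⌋₊ + 1), ‖G i‖)
    (by simp) hm.aestronglyMeasurable ?_
  filter_upwards [ae_restrict_mem measurableSet_Icc] with t ht
  refine Finset.single_le_sum (f := fun i => ‖G i‖) (fun i _ => norm_nonneg _) ?_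
  rw [Finset.mem_range, Nat.lt_succ_iff]
  have := ht.2
  gcongr

/-- The primitive of a step function is the piecewise affine interpolation of its partial sums. -/
theorem integral_comp_floor {E : Type*} [NormedAddCommGroup E] [NormedSpace ℝ E] [CompleteSpace E]
    {h : ℝ} (hh : 0 < h) {G x : ℕ → E} (hx : ∀ k, x (k + 1) = x k + h • G k) (k : ℕ) {t : ℝ}
    (ht : t ∈ Icc (k * h) ((k + 1) * h)) :
    x 0 + ∫ s in (0 : ℝ)..t, G ⌊s / h⌋₊ = x k + (t - k * h) • G k := by
  have hint : ∀ a b : ℝ, 0 ≤ a → 0 ≤ b →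
      IntervalIntegrable (fun s : ℝ => G ⌊s / h⌋₊) volume a b := fun a b ha hb => by
    rw [intervalIntegrable_iff]
    refine (integrableOn_comp_floor h G (max a b) hh).mono_set fun s hs => ?_
    exact ⟨(le_min ha hb).trans hs.1.le, hs.2⟩
  have hcell : ∀ k : ℕ, ∀ t ∈ Icc (k * h) ((k + 1) * h),
      ∫ s in (k * h)..t, G ⌊s / h⌋₊ = (t - k * h) • G k := fun k t ht => by
    rw [← intervalIntegral.integral_const]
    refine intervalIntegral.integral_congr_Ioo_of_le ht.1 fun s hs => ?_
    have : ⌊s / h⌋₊ = k := by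
      have h0 : (0 : ℝ) ≤ k * h := by positivity
      rw [Nat.floor_eq_iff (div_nonneg (h0.trans hs.1.le) hh.le), le_div_iff₀ hh, div_lt_iff₀ hh]
      exact ⟨hs.1.le, hs.2.trans_le ht.2⟩
    simp only [this]
  induction k generalizing t with
  | zero => simpa using hcell 0 t ht
  | succ k ih =>
    have h0 : (0 : ℝ) ≤ ((k + 1 : ℕ) : ℝ) * h := by positivity
    have h1 := ih (t := (k + 1 : ℕ) * h) (by
      push_cast
      exact ⟨by nlinarith, le_rfl⟩)
    rw [← intervalIntegral.integral_add_adjacent_intervals (hint 0 _ le_rfl h0)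
      (hint _ t h0 (h0.trans ht.1)), ← add_assoc, h1, hcell _ t ht, hx,
      show ((k + 1 : ℕ) : ℝ) * h - k * h = h by push_cast; ring]

/-- The catching-up algorithm produces approximate solutions of arbitrary precision. -/
theorem exists_isApproxSol [CompleteSpace H] {F : ℝ → H → H} {K D : NNReal} {C : Set H}
    {T r c : ℝ} {w₀ : H} (hr : 0 < r) (hc : 0 ≤ c)
    (hF : ∀ s t x y, ‖F s x - F t y‖ ≤ D * |s - t| + K * ‖x - y‖)
    (hgrowth : ∀ t ∈ Icc (0 : ℝ) T, ∀ x, ‖F t x‖ ≤ c * (1 + ‖x‖))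
    (hC : ∀ t ∈ Icc (0 : ℝ) T, DirProxRegular r (F t) C) (hw₀ : w₀ ∈ C) :
    ∃ A M : ℝ, 0 ≤ A ∧ 0 ≤ M ∧ ∀ ε > 0, ε ≤ 1 →
      ∃ g p : ℝ → H, IsApproxSol F C T w₀ A M ε g p := by
  set M := c * (Real.exp (2 * c * T) * (1 + ‖w₀‖)) with hM
  have hM0 : 0 ≤ M := by positivity
  refine ⟨M / (2 * r), 2 * M + 1, by positivity, by positivity, fun ε hε hε1 => ?_⟩
  obtain ⟨h, hh, hhr, hhε⟩ : ∃ h : ℝ, 0 < h ∧ h * M < r ∧ h * (2 * M + D + K * (2 * M)) ≤ ε := by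
    have hev : ∀ N b : ℝ, 0 < b → ∀ᶠ h : ℝ in 𝓝[>] 0, h * N < b := fun N b hb => by
      have : Tendsto (fun h : ℝ => h * N) (𝓝 0) (𝓝 (0 * N)) := tendsto_id.mul_const _
      rw [zero_mul] at this
      exact (this.mono_left nhdsWithin_le_nhds).eventually_lt_const hb
    have hpos : ∀ᶠ h : ℝ in 𝓝[>] 0, 0 < h := self_mem_nhdsWithin
    obtain ⟨h, h1, h2, h3⟩ := (hpos.and ((hev M r hr).and (hev _ ε hε))).exists
    exact ⟨h, h1, h2, h3.le⟩
  have hres : ∀ t x, t ∈ Icc (0 : ℝ) T ∧ x ∈ C ∧ ‖F t x‖ ≤ M → _ := fun t x hx =>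
    (hC t hx.1).exists_residual hr hx.2.1 hh
      ((mul_le_mul_of_nonneg_left hx.2.2 hh.le).trans_lt hhr)
  choose! q hqC hqmin hqn using hres
  let x : ℕ → H := fun k => Nat.rec w₀ (fun k z => z + h • (F (k * h) z - q (k * h) z)) k
  let G : ℕ → H := fun k => F (k * h) (x k) - q (k * h) (x k)
  have hx : ∀ k, x (k + 1) = x k + h • G k := fun k => rfl
  have hgood : ∀ k : ℕ, k * h ≤ T → 1 + ‖x k‖ ≤ (1 + 2 * h * c) ^ k * (1 + ‖w₀‖) →
      ‖F (k * h) (x k)‖ ≤ M := fun k hk hxk => by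
    refine (hgrowth _ ⟨by positivity, hk⟩ _).trans ?_
    rw [hM]
    gcongr
    refine hxk.trans ?_
    gcongr
    calc (1 + 2 * h * c) ^ k ≤ Real.exp (2 * h * c) ^ k := by
          gcongr
          linarith [Real.add_one_le_exp (2 * h * c)]
      _ = Real.exp (2 * c * (k * h)) := by rw [← Real.exp_nat_mul]; ring_nf
      _ ≤ _ := by gcongr
  have hq : ∀ k : ℕ, k * h ≤ T → x k ∈ C → ‖F (k * h) (x k)‖ ≤ M →
      ‖q (k * h) (x k)‖ ≤ ‖F (k * h) (x k)‖ := fun k hk hxk hFk => by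
    have := hqmin _ _ ⟨⟨by positivity, hk⟩, hxk, hFk⟩ _ hxk
    rw [add_sub_cancel_left, norm_smul, Real.norm_of_nonneg hh.le] at this
    exact le_of_mul_le_mul_left this hh
  have hind : ∀ k : ℕ, k * h ≤ T → x k ∈ C ∧ 1 + ‖x k‖ ≤ (1 + 2 * h * c) ^ k * (1 + ‖w₀‖) := by
    intro k
    induction k with
    | zero => exact fun _ => ⟨hw₀, by simp [x]⟩
    | succ k ih =>
      intro hk
      have hk' : k * h ≤ T := by push_cast at hk; linarith
      obtain ⟨hxC, hxn⟩ := ih hk'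
      have hFk := hgood k hk' hxn
      refine ⟨hqC _ _ ⟨⟨by positivity, hk'⟩, hxC, hFk⟩, ?_⟩
      have h1 : ‖G k‖ ≤ 2 * (c * (1 + ‖x k‖)) := by
        have h2 := norm_sub_le (F (k * h) (x k)) (q (k * h) (x k))
        have h3 := hq k hk' hxC hFk
        have h4 := hgrowth _ ⟨by positivity, hk'⟩ (x k)
        linarith
      calc 1 + ‖x (k + 1)‖ ≤ 1 + (‖x k‖ + h * (2 * (c * (1 + ‖x k‖)))) := by
            rw [hx]
            gcongr
            refine (norm_add_le _ _).trans ?_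
            rw [norm_smul, Real.norm_of_nonneg hh.le]
            gcongr
        _ = (1 + 2 * h * c) * (1 + ‖x k‖) := by ring
        _ ≤ (1 + 2 * h * c) * ((1 + 2 * h * c) ^ k * (1 + ‖w₀‖)) := by gcongr
        _ = _ := by ring
  have hfloor : ∀ t ∈ Icc (0 : ℝ) T, (⌊t / h⌋₊ : ℝ) * h ≤ t ∧ t ≤ (⌊t / h⌋₊ + 1) * h :=
    fun t ht => ⟨(le_div_iff₀ hh).1 (Nat.floor_le (div_nonneg ht.1 hh.le)),
      ((div_lt_iff₀ hh).1 (Nat.lt_floor_add_one _)).le⟩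
  have hstep : ∀ t ∈ Icc (0 : ℝ) T, x ⌊t / h⌋₊ ∈ C ∧
      ‖F (⌊t / h⌋₊ * h) (x ⌊t / h⌋₊)‖ ≤ M ∧
      ‖q (⌊t / h⌋₊ * h) (x ⌊t / h⌋₊)‖ ≤ M ∧ ‖G ⌊t / h⌋₊‖ ≤ 2 * M := fun t ht => by
    have hk := (hfloor t ht).1.trans ht.2
    obtain ⟨h1, h2⟩ := hind _ hk
    have h3 := hgood _ hk h2
    have h4 := (hq _ hk h1 h3).trans h3
    exact ⟨h1, h3, h4, (norm_sub_le _ _).trans (by linarith)⟩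
  have hw : ∀ t ∈ Icc (0 : ℝ) T, w₀ + ∫ s in (0 : ℝ)..t, G ⌊s / h⌋₊ =
      x ⌊t / h⌋₊ + (t - ⌊t / h⌋₊ * h) • G ⌊t / h⌋₊ := fun t ht =>
    integral_comp_floor hh hx _ (hfloor t ht)
  have hfield : ∀ t ∈ Icc (0 : ℝ) T,
      ‖F t (w₀ + ∫ s in (0 : ℝ)..t, G ⌊s / h⌋₊) - F (⌊t / h⌋₊ * h) (x ⌊t / h⌋₊)‖ ≤ ε :=
    fun t ht => by
    obtain ⟨hf1, hf2⟩ := hfloor t ht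
    have h1 : |t - ⌊t / h⌋₊ * h| ≤ h := abs_le.2 ⟨by linarith, by linarith⟩
    refine (hF _ _ _ _).trans ?_
    rw [hw t ht, add_sub_cancel_left, norm_smul, Real.norm_eq_abs]
    have h2 : |t - ⌊t / h⌋₊ * h| * ‖G ⌊t / h⌋₊‖ ≤ h * (2 * M) := by
      gcongr
      exact (hstep t ht).2.2.2
    have h3 : (D : ℝ) * |t - ⌊t / h⌋₊ * h| ≤ D * h := by gcongr
    have h4 := mul_le_mul_of_nonneg_left h2 K.coe_nonneg
    have h5 := mul_nonneg hh.le hM0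
    linarith
  refine ⟨fun t => G ⌊t / h⌋₊, fun t => x (⌊t / h⌋₊ + 1), integrableOn_comp_floor h G T hh,
    fun t ht => ?_, fun t ht => ?_, ?_, ?_, ?_⟩
  · obtain ⟨h1, h2, -⟩ := hstep t ht
    exact hqC _ _ ⟨⟨by positivity, (hfloor t ht).1.trans ht.2⟩, h1, h2⟩
  · obtain ⟨hf1, hf2⟩ := hfloor t ht
    rw [hw t ht, hx, add_sub_add_left_eq_sub, ← sub_smul, norm_smul, Real.norm_eq_abs]
    have h1 : |t - ⌊t / h⌋₊ * h - h| ≤ h := abs_le.2 ⟨by linarith, by linarith⟩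
    have h2 : |t - ⌊t / h⌋₊ * h - h| * ‖G ⌊t / h⌋₊‖ ≤ h * (2 * M) := by
      gcongr
      exact (hstep t ht).2.2.2
    have h3 : 0 ≤ h * (D + K * (2 * M)) := by positivity
    linarith
  · filter_upwards [ae_restrict_mem measurableSet_Icc] with t ht
    linarith [(hstep t ht).2.2.2]
  · filter_upwards [ae_restrict_mem measurableSet_Icc] with t ht
    rw [show ∀ a : H, a - G ⌊t / h⌋₊ = (a - F (⌊t / h⌋₊ * h) (x ⌊t / h⌋₊)) +
      q (⌊t / h⌋₊ * h) (x ⌊t / h⌋₊) from fun a => by simp only [G]; abel]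
    refine (norm_add_le _ _).trans ?_
    linarith [hfield t ht, (hstep t ht).2.2.1]
  · filter_upwards [ae_restrict_mem measurableSet_Icc] with t ht y hy
    obtain ⟨h1, h2, h3, -⟩ := hstep t ht
    have hn := hqn _ _ ⟨⟨by positivity, (hfloor t ht).1.trans ht.2⟩, h1, h2⟩ y hy
    change inner ℝ _ (y - x (_ + 1)) ≤ _ * ‖y - x (_ + 1)‖ ^ 2 at hn
    have hsplit : F t (w₀ + ∫ s in (0 : ℝ)..t, G ⌊s / h⌋₊) - G ⌊t / h⌋₊ =
        q (⌊t / h⌋₊ * h) (x ⌊t / h⌋₊) + (F t (w₀ + ∫ s in (0 : ℝ)..t, G ⌊s / h⌋₊) -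
          F (⌊t / h⌋₊ * h) (x ⌊t / h⌋₊)) := by simp only [G]; abel
    rw [hsplit, inner_add_left]
    refine add_le_add (hn.trans ?_) ((real_inner_le_norm _ _).trans ?_)
    · gcongr
    · gcongr
      exact hfield t ht

/-- Almost everywhere inequalities pass to weak limits. -/
theorem ae_le_inner_of_tendsto_integral_inner {α ι : Type*} [MeasurableSpace α] {μ : Measure α}
    [IsFiniteMeasure μ] {l : Filter ι} [l.NeBot] {g : ι → α → H} {G z : α → H} {c : α → ℝ}
    {κ : ι → ℝ} {M : ℝ} (hgm : ∀ i, AEStronglyMeasurable (g i) μ)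
    (hgM : ∀ i, ∀ᵐ t ∂μ, ‖g i t‖ ≤ M) (hG : MemLp G 2 μ) (hz : MemLp z 2 μ)
    (hc : Integrable c μ) (hκ : Tendsto κ l (𝓝 0))
    (hlim : ∀ φ : α → H, MemLp φ 2 μ → Tendsto (fun i => ∫ t, inner ℝ (g i t) (φ t) ∂μ) l
      (𝓝 (∫ t, inner ℝ (G t) (φ t) ∂μ)))
    (hle : ∀ i, ∀ᵐ t ∂μ, c t - κ i ≤ inner ℝ (g i t) (z t)) :
    ∀ᵐ t ∂μ, c t ≤ inner ℝ (G t) (z t) := by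
  have hint : ∀ {b : α → H}, MemLp b 2 μ → Integrable (fun t => inner ℝ (b t) (z t)) μ :=
    fun {b} hb => (L2.integrable_inner (𝕜 := ℝ) (hb.toLp b) (hz.toLp z)).congr (by
      filter_upwards [hb.coeFn_toLp, hz.coeFn_toLp] with t h1 h2
      rw [h1, h2])
  have hind : ∀ (b : α → H) {s : Set α}, MeasurableSet s →
      ∫ t, inner ℝ (b t) (s.indicator z t) ∂μ = ∫ t in s, inner ℝ (b t) (z t) ∂μ :=
    fun b s hs => by
    rw [← integral_indicator hs]
    congr 1 with t
    by_cases h : t ∈ s <;> simp [h]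
  refine ae_le_of_forall_setIntegral_le hc (hint hG) fun s hs _ => ?_
  have h1 := hlim _ (hz.indicator hs)
  simp only [hind _ hs] at h1
  have h2 : Tendsto (fun i => ∫ t in s, c t ∂μ - μ.real s * κ i) l (𝓝 (∫ t in s, c t ∂μ)) := by
    simpa using (hκ.const_mul (μ.real s)).const_sub (∫ t in s, c t ∂μ)
  refine le_of_tendsto_of_tendsto' h2 h1 fun i => ?_
  have h3 : ∫ t in s, (c t - κ i) ∂μ = ∫ t in s, c t ∂μ - μ.real s * κ i := by
    rw [integral_sub hc.integrableOn (integrable_const _)]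
    simp
  rw [← h3]
  exact setIntegral_mono_ae (hc.sub (integrable_const _)).integrableOn
    (hint (MemLp.of_bound (hgm i) M (hgM i))).integrableOn (hle i)

theorem inner_intervalIntegral_eq_integral_inner_indicator [CompleteSpace H] {T t : ℝ} {g : ℝ → H}
    (hg : IntegrableOn g (Icc 0 T)) (ht : t ∈ Icc (0 : ℝ) T) (e : H) :
    inner ℝ (∫ s in (0 : ℝ)..t, g s) e =
      ∫ s in Icc (0 : ℝ) T, inner ℝ (g s) ((Ioc 0 t).indicator (fun _ => e) s) := by
  have hsub : Ioc 0 t ⊆ Icc 0 T := fun s hs => ⟨hs.1.le, hs.2.trans ht.2⟩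
  have h : ∀ s, inner ℝ (g s) ((Ioc 0 t).indicator (fun _ => e) s) =
      (Ioc 0 t).indicator (fun s => inner ℝ e (g s)) s := fun s => by
    by_cases h : s ∈ Ioc 0 t
    · simp only [indicator_of_mem h, real_inner_comm]
    · simp only [indicator_of_notMem h, inner_zero_right]
  simp only [h]
  rw [setIntegral_indicator measurableSet_Ioc, inter_eq_self_of_subset_right hsub,
    integral_inner (hg.mono_set hsub), intervalIntegral.integral_of_le ht.1, real_inner_comm]

/-- The normal inequality of an approximate solution, transferred to a nearby point. -/
theorem inner_sub_le_of_approx {x p f f₁ g y : H} {A M R ρ ε θ : ℝ} (hA : 0 ≤ A)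
    (hε : 0 ≤ ε) (hf : ‖f - f₁‖ ≤ ρ) (hp : ‖x - p‖ ≤ θ) (hM : ‖f₁ - g‖ ≤ M) (hR : ‖y - x‖ ≤ R)
    (hn : inner ℝ (f₁ - g) (y - p) ≤ A * ‖y - p‖ ^ 2 + ε * ‖y - p‖) :
    inner ℝ (f - g) (y - x) ≤
      A * ‖y - x‖ ^ 2 + (ρ * R + A * (2 * R * θ + θ ^ 2) + ε * (R + θ) + M * θ) := by
  have hθ : 0 ≤ θ := (norm_nonneg _).trans hp
  have hρ : 0 ≤ ρ := (norm_nonneg _).trans hf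
  have hM0 : 0 ≤ M := (norm_nonneg _).trans hM
  have hd : ‖y - p‖ ≤ ‖y - x‖ + θ := by
    calc ‖y - p‖ = ‖(y - x) + (x - p)‖ := by congr 1; abel
      _ ≤ _ := (norm_add_le _ _).trans (by gcongr)
  have h1 : inner ℝ (f - f₁) (y - x) ≤ ρ * R := (real_inner_le_norm _ _).trans (by gcongr)
  have h2 : inner ℝ (f₁ - g) (p - x) ≤ M * θ :=
    (real_inner_le_norm _ _).trans (by rw [norm_sub_rev p x]; gcongr)
  have h3 : ‖y - p‖ ^ 2 ≤ ‖y - x‖ ^ 2 + (2 * R * θ + θ ^ 2) := by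
    have := pow_le_pow_left₀ (norm_nonneg _) hd 2
    nlinarith [mul_le_mul_of_nonneg_right hR hθ]
  have h4 := mul_le_mul_of_nonneg_left h3 hA
  have h5 := mul_le_mul_of_nonneg_left (hd.trans (add_le_add_left hR θ)) hε
  have hsplit : inner ℝ (f - g) (y - x) = inner ℝ (f - f₁) (y - x) +
      inner ℝ (f₁ - g) (y - p) + inner ℝ (f₁ - g) (p - x) := by
    simp only [inner_sub_left, inner_sub_right]; ring
  rw [hsplit]
  linarith

/-- The normal inequality at countably many points gives a proximal normal. -/
theorem ae_mem_proxNormalCone [SecondCountableTopology H] {α : Type*} [MeasurableSpace α]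
    {μ : Measure α} {C : Set H} {A : ℝ} {v x : α → H} (hx : ∀ᵐ t ∂μ, x t ∈ C)
    (h : ∀ y ∈ C, ∀ᵐ t ∂μ, inner ℝ (v t) (y - x t) ≤ A * ‖y - x t‖ ^ 2) :
    ∀ᵐ t ∂μ, v t ∈ proxNormalCone C (x t) := by
  obtain ⟨s, hs, hsd⟩ := TopologicalSpace.exists_countable_dense C
  have hae : ∀ᵐ t ∂μ, ∀ y ∈ s, inner ℝ (v t) ((y : H) - x t) ≤ A * ‖(y : H) - x t‖ ^ 2 :=
    (ae_ball_iff hs).2 fun y _ => h y y.2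
  filter_upwards [hx, hae] with t htx ht
  refine mem_proxNormalCone_iff.2 ⟨htx, A, fun y hy => ?_⟩
  have hcl : IsClosed {y : C | inner ℝ (v t) ((y : H) - x t) ≤ A * ‖(y : H) - x t‖ ^ 2} :=
    isClosed_le (by fun_prop) (by fun_prop)
  exact hcl.closure_subset_iff.2 ht (hsd ⟨y, hy⟩)

/-- Existence for the perturbed sweeping process with a fixed set. -/
theorem exists_solution_of_dirProxRegular [CompleteSpace H] [SecondCountableTopology H]
    {F : ℝ → H → H} {K D : NNReal} {C : Set H} {T r c : ℝ} {w₀ : H} (hr : 0 < r) (hc : 0 ≤ c)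
    (hT : 0 ≤ T) (hCc : IsClosed C)
    (hF : ∀ s t x y, ‖F s x - F t y‖ ≤ D * |s - t| + K * ‖x - y‖)
    (hgrowth : ∀ t ∈ Icc (0 : ℝ) T, ∀ x, ‖F t x‖ ≤ c * (1 + ‖x‖))
    (hC : ∀ t ∈ Icc (0 : ℝ) T, DirProxRegular r (F t) C) (hw₀ : w₀ ∈ C) :
    ∃ G : ℝ → H, IntegrableOn G (Icc 0 T) ∧
      (∀ t ∈ Icc (0 : ℝ) T, w₀ + ∫ s in (0 : ℝ)..t, G s ∈ C) ∧
      ∀ᵐ t ∂volume.restrict (Icc (0 : ℝ) T), F t (w₀ + ∫ s in (0 : ℝ)..t, G s) - G t ∈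
        proxNormalCone C (w₀ + ∫ s in (0 : ℝ)..t, G s) := by
  obtain ⟨A, M, hA, hM, happ⟩ := exists_isApproxSol hr hc hF hgrowth hC hw₀
  have hFx : ∀ t x y, ‖F t x - F t y‖ ≤ K * ‖x - y‖ := fun t x y => by simpa using hF t t x y
  let ε : ℕ → ℝ := fun n => 1 / ((n : ℝ) + 1) / 2
  have hε0 : ∀ n, 0 < ε n := fun n => by positivity
  have hε_anti : ∀ {m n}, m ≤ n → ε n ≤ ε m := fun h => by simp only [ε]; gcongr
  have hε_half : ∀ n, ε n ≤ 1 / 2 := fun n => (hε_anti n.zero_le).trans (by simp [ε])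
  have hε_lim : Tendsto ε atTop (𝓝 0) := by
    simpa [ε] using (tendsto_one_div_add_atTop_nhds_zero_nat (𝕜 := ℝ)).div_const 2
  choose g p hgp using fun n => happ (ε n) (hε0 n) ((hε_half n).trans (by norm_num))
  let W : ℕ → ℝ → H := fun n t => w₀ + ∫ s in (0 : ℝ)..t, g n s
  let B := 2 * (4 * A + 2 + 2 * M) * T * Real.exp (2 * (K + 4 * A + 1) * T)
  have hB : 0 ≤ B := by positivity
  let η : ℕ → ℝ := fun n => √(B * (2 * ε n))
  have hη_lim : Tendsto η atTop (𝓝 0) := by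
    have := ((hε_lim.const_mul 2).const_mul B).sqrt
    simpa using this
  have hdist : ∀ t ∈ Icc (0 : ℝ) T, ∀ n m, n ≤ m → dist (W n t) (W m t) ≤ η n :=
    fun t ht n m hnm => by
    rw [dist_eq_norm]
    refine Real.le_sqrt_of_sq_le ?_
    refine (IsApproxSol.norm_sub_sq_le hFx hA hM ?_ (hgp n) (hgp m) ht).trans ?_
    · linarith [hε_half n, hε_half m]
    · have := hε_anti hnm
      refine mul_le_mul_of_nonneg_left ?_ hB
      linarith
  have hcauchy : ∀ t, ∃ x, t ∈ Icc (0 : ℝ) T → Tendsto (fun n => W n t) atTop (𝓝 x) := fun t => by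
    by_cases ht : t ∈ Icc (0 : ℝ) T
    · obtain ⟨x, hx⟩ := cauchySeq_tendsto_of_complete (cauchySeq_of_le_tendsto_0' η (hdist t ht) hη_lim)
      exact ⟨x, fun _ => hx⟩
    · exact ⟨0, fun h => absurd h ht⟩
  choose w hw using hcauchy
  have hWw : ∀ t ∈ Icc (0 : ℝ) T, ∀ n, ‖w t - W n t‖ ≤ η n := fun t ht n => by
    rw [← dist_eq_norm, dist_comm]
    refine le_of_tendsto (tendsto_const_nhds.dist (hw t ht)) ?_
    filter_upwards [eventually_ge_atTop n] with m hm using hdist t ht n m hm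
  have hwp : ∀ t ∈ Icc (0 : ℝ) T, ∀ n, ‖w t - p n t‖ ≤ η n + ε n := fun t ht n =>
    (norm_sub_le_norm_sub_add_norm_sub _ (W n t) _).trans
      (add_le_add (hWw t ht n) ((hgp n).norm_sub_le t ht))
  have hwC : ∀ t ∈ Icc (0 : ℝ) T, w t ∈ C := fun t ht => by
    refine hCc.mem_of_tendsto (f := fun n => p n t) (b := atTop) ?_
      (Eventually.of_forall fun n => (hgp n).mem t ht)
    rw [tendsto_iff_norm_sub_tendsto_zero]
    refine squeeze_zero (fun _ => norm_nonneg _) (fun n => ?_)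
      (by simpa using hη_lim.add hε_lim)
    rw [norm_sub_rev]
    exact hwp t ht n
  have hgm : ∀ n, AEStronglyMeasurable (g n) (volume.restrict (Icc (0 : ℝ) T)) :=
    fun n => (hgp n).integrableOn.aestronglyMeasurable
  obtain ⟨G, hG2, hG⟩ := exists_tendsto_integral_inner_of_norm_le (hyperfilter ℕ) hgm
    fun n => (hgp n).norm_velocity_le
  have hU : (hyperfilter ℕ : Filter ℕ) ≤ atTop := Nat.hyperfilter_le_atTop
  have hGi : IntegrableOn G (Icc 0 T) := hG2.integrable one_le_two
  have hwG : ∀ t ∈ Icc (0 : ℝ) T, w₀ + ∫ s in (0 : ℝ)..t, G s = w t := fun t ht => by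
    refine ext_inner_right ℝ fun e => ?_
    have h1 := hG _ ((memLp_const e).indicator (measurableSet_Ioc (a := 0) (b := t)))
    simp only [← inner_intervalIntegral_eq_integral_inner_indicator (hgp _).integrableOn ht e,
      ← inner_intervalIntegral_eq_integral_inner_indicator hGi ht e] at h1
    refine tendsto_nhds_unique ?_ (((hw t ht).mono_left hU).inner (tendsto_const_nhds (x := e)))
    simp only [W, inner_add_left]
    exact h1.const_add _
  refine ⟨G, hGi, fun t ht => by rw [hwG t ht]; exact hwC t ht, ?_⟩
  suffices h : ∀ᵐ t ∂volume.restrict (Icc (0 : ℝ) T), F t (w t) - G t ∈ proxNormalCone C (w t) by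
    filter_upwards [h, ae_restrict_mem measurableSet_Icc] with t h ht
    rwa [hwG t ht]
  have hwc : ContinuousOn w (Icc 0 T) :=
    (continuousOn_primitive_add w₀ hGi).congr fun t ht => (hwG t ht).symm
  have hFwc := continuousOn_field_comp hF hwc
  refine ae_mem_proxNormalCone (A := A)
    ((ae_restrict_mem measurableSet_Icc).mono hwC) fun y hy => ?_
  have hyc : ContinuousOn (fun t => y - w t) (Icc 0 T) := continuousOn_const.sub hwc
  obtain ⟨R, hR⟩ := isCompact_Icc.exists_bound_of_continuousOn hyc
  have hz : MemLp (fun t => y - w t) 2 (volume.restrict (Icc (0 : ℝ) T)) :=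
    MemLp.of_bound (hyc.aestronglyMeasurable measurableSet_Icc) R
      ((ae_restrict_mem measurableSet_Icc).mono hR)
  have hint : IntegrableOn
      (fun t => inner ℝ (F t (w t)) (y - w t) - A * ‖y - w t‖ ^ 2) (Icc 0 T) :=
    ((hFwc.inner hyc).sub (continuousOn_const.mul (hyc.norm.pow 2))).integrableOn_Icc
  let κ : ℕ → ℝ := fun n => K * η n * R + A * (2 * R * (η n + ε n) + (η n + ε n) ^ 2) +
    ε n * (R + (η n + ε n)) + M * (η n + ε n)
  have hκ : Tendsto κ atTop (𝓝 0) := by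
    have h := hη_lim.add hε_lim
    have := ((((hη_lim.const_mul (K : ℝ)).mul_const R).add
      (((h.const_mul (2 * R)).add (h.pow 2)).const_mul A)).add
      (hε_lim.mul (h.const_add R))).add (h.const_mul M)
    simpa using this
  have hfinal := ae_le_inner_of_tendsto_integral_inner hgm (fun n => (hgp n).norm_velocity_le)
    hG2 hz hint (hκ.mono_left hU) hG fun n => by
      filter_upwards [(hgp n).norm_residual_le, (hgp n).inner_le,
        ae_restrict_mem measurableSet_Icc] with t h1 h2 ht
      have hf : ‖F t (w t) - F t (W n t)‖ ≤ K * η n :=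
        (hFx t _ _).trans (by gcongr; exact hWw t ht n)
      have := inner_sub_le_of_approx hA (hε0 n).le hf (hwp t ht n) h1 (hR t ht) (h2 y hy)
      rw [inner_sub_left] at this
      simp only [κ]
      linarith
  filter_upwards [hfinal] with t ht
  rw [inner_sub_left]
  linarith

/-- Uniqueness for the perturbed sweeping process with a fixed set. -/
theorem eqOn_of_dirProxRegular [CompleteSpace H] {F : ℝ → H → H} {K D : NNReal} {C : Set H}
    {T r : ℝ} {w₀ : H} {g₁ g₂ : ℝ → H} (hr : 0 < r)
    (hF : ∀ s t x y, ‖F s x - F t y‖ ≤ D * |s - t| + K * ‖x - y‖)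
    (hC : ∀ t ∈ Icc (0 : ℝ) T, DirProxRegular r (F t) C)
    (hg₁ : IntegrableOn g₁ (Icc 0 T)) (hg₂ : IntegrableOn g₂ (Icc 0 T))
    (hmem₁ : ∀ t ∈ Icc (0 : ℝ) T, w₀ + ∫ s in (0 : ℝ)..t, g₁ s ∈ C)
    (hmem₂ : ∀ t ∈ Icc (0 : ℝ) T, w₀ + ∫ s in (0 : ℝ)..t, g₂ s ∈ C)
    (hn₁ : ∀ᵐ t ∂volume.restrict (Icc (0 : ℝ) T),
      F t (w₀ + ∫ s in (0 : ℝ)..t, g₁ s) - g₁ t ∈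
        proxNormalCone C (w₀ + ∫ s in (0 : ℝ)..t, g₁ s))
    (hn₂ : ∀ᵐ t ∂volume.restrict (Icc (0 : ℝ) T),
      F t (w₀ + ∫ s in (0 : ℝ)..t, g₂ s) - g₂ t ∈
        proxNormalCone C (w₀ + ∫ s in (0 : ℝ)..t, g₂ s)) :
    EqOn (fun t => w₀ + ∫ s in (0 : ℝ)..t, g₁ s) (fun t => w₀ + ∫ s in (0 : ℝ)..t, g₂ s)
      (Icc 0 T) := by
  obtain ⟨M₁, h₁⟩ := exists_isApproxSol_zero hr hF hC hg₁ hmem₁ hn₁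
  obtain ⟨M₂, h₂⟩ := exists_isApproxSol_zero hr hF hC hg₂ hmem₂ hn₂
  set M := max 0 (max M₁ M₂)
  have hM : 0 ≤ M := le_max_left _ _
  intro t ht
  have h := IsApproxSol.norm_sub_sq_le (fun t x y => by simpa using hF t t x y)
    (by positivity) hM (by norm_num)
    (h₁ M ((le_max_left _ _).trans (le_max_right _ _)))
    (h₂ M ((le_max_right _ _).trans (le_max_right _ _))) ht
  rw [add_zero, mul_zero] at h
  exact sub_eq_zero.1 (norm_eq_zero.1 (pow_eq_zero_iff two_ne_zero |>.1
    (le_antisymm h (sq_nonneg _))))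

theorem mem_proxNormalCone_image_add_iff {C : Set H} {b x v : H} :
    v ∈ proxNormalCone ((fun y => y + b) '' C) (x + b) ↔ v ∈ proxNormalCone C x := by
  simp only [mem_proxNormalCone_iff, (add_left_injective b).mem_set_image, forall_mem_image,
    add_sub_add_right_eq_sub]

theorem intervalIntegral_add_const {E : Type*} [NormedAddCommGroup E] [NormedSpace ℝ E]
    [CompleteSpace E] {T t : ℝ} {g : ℝ → E} (hg : IntegrableOn g (Icc 0 T)) (a : E)
    (ht : t ∈ Icc (0 : ℝ) T) :
    ∫ s in (0 : ℝ)..t, (g s + a) = (∫ s in (0 : ℝ)..t, g s) + t • a := by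
  rw [intervalIntegral.integral_add ((intervalIntegrable_iff_integrableOn_Icc_of_le ht.1).2
    (hg.mono_set (Icc_subset_Icc_right ht.2))) intervalIntegrable_const]
  simp

/-- Solutions for a translating set correspond to solutions for the fixed set. -/
theorem IsSweepingSol.exists_fixed [CompleteSpace H] {C : Set H} {f : H → H} {T : ℝ} {a u₀ : H}
    {u : ℝ → H} (hu : IsSweepingSol (fun t => (fun x => x + t • a) '' C) f T u₀ u) :
    ∃ g : ℝ → H, IntegrableOn g (Icc 0 T) ∧
      (∀ t ∈ Icc (0 : ℝ) T, u t = (u₀ + ∫ s in (0 : ℝ)..t, g s) + t • a) ∧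
      (∀ t ∈ Icc (0 : ℝ) T, u₀ + ∫ s in (0 : ℝ)..t, g s ∈ C) ∧
      ∀ᵐ t ∂volume.restrict (Icc (0 : ℝ) T),
        f ((u₀ + ∫ s in (0 : ℝ)..t, g s) + t • a) - a - g t ∈
          proxNormalCone C (u₀ + ∫ s in (0 : ℝ)..t, g s) := by
  obtain ⟨g, hg, hug, humem, hun⟩ := hu
  have hga : IntegrableOn (fun t => g t - a) (Icc 0 T) := hg.sub (integrable_const a)
  have hu' : ∀ t ∈ Icc (0 : ℝ) T, u t = (u₀ + ∫ s in (0 : ℝ)..t, (g s - a)) + t • a :=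
    fun t ht => by
    rw [hug t ht, add_assoc, ← intervalIntegral_add_const hga a ht]
    simp
  refine ⟨fun t => g t - a, hga, hu', fun t ht => ?_, ?_⟩
  · have h := humem t ht
    rw [hu' t ht] at h
    simpa using h
  · filter_upwards [hun, ae_restrict_mem measurableSet_Icc] with t h ht
    rw [hu' t ht, mem_proxNormalCone_image_add_iff] at h
    convert h using 1
    abel

end

/-- **Sweeping process in a Hilbert space with a translating set.** Let `H` be a
separable Hilbert space, `r > 0`, and `f : H → H` Lipschitz with at most linear growth.
Let `a ∈ H` and let `C₀` be a nonempty closed subset of `H` which is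
`(r, f(· + t a) - a)`-prox-regular for every `t ∈ I`, and set `C(t) = C₀ + t a`. Then
for every `u₀ ∈ C₀` the sweeping process `u̇(t) + N(C(t),u(t)) ∋ f(u(t))`, `u(0) = u₀`,
has one and only one absolutely continuous solution `u`, with `u(t) ∈ C(t)` on `I`. -/
theorem sweeping_process_hilbert_translation
    {H : Type*} [NormedAddCommGroup H] [InnerProductSpace ℝ H] [CompleteSpace H]
    [TopologicalSpace.SeparableSpace H]
    (T : ℝ) (hT : 0 < T)
    (f : H → H) (K : NNReal) (hflip : LipschitzWith K f)
    (L : ℝ) (hL : 0 < L) (hfgrowth : ∀ x, ‖f x‖ ≤ L * (1 + ‖x‖))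
    (r : ℝ) (hr : 0 < r) (a : H)
    (C₀ : Set H) (hC₀ne : C₀.Nonempty) (hC₀closed : IsClosed C₀)
    (hC₀prox : ∀ t ∈ Set.Icc (0:ℝ) T,
      DirProxRegular r (fun x => f (x + t • a) - a) C₀)
    (u₀ : H) (hu₀ : u₀ ∈ C₀) :
    (∃ u : ℝ → H,
      IsSweepingSol (fun t => (fun x => x + t • a) '' C₀) f T u₀ u) ∧
      ∀ u v : ℝ → H,
        IsSweepingSol (fun t => (fun x => x + t • a) '' C₀) f T u₀ u →
        IsSweepingSol (fun t => (fun x => x + t • a) '' C₀) f T u₀ v →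
        Set.EqOn u v (Set.Icc 0 T) := by
  set F : ℝ → H → H := fun t x => f (x + t • a) - a with hFdef
  have hF : ∀ s t x y, ‖F s x - F t y‖ ≤ (K * ‖a‖₊ : NNReal) * |s - t| + K * ‖x - y‖ :=
    fun s t x y => by
    have h := hflip.dist_le_mul (x + s • a) (y + t • a)
    rw [dist_eq_norm, dist_eq_norm] at h
    simp only [hFdef, sub_sub_sub_cancel_right]
    refine h.trans ?_
    have h2 : ‖x + s • a - (y + t • a)‖ ≤ ‖x - y‖ + |s - t| * ‖a‖ := by
      rw [add_sub_add_comm, ← sub_smul, ← Real.norm_eq_abs, ← norm_smul]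
      exact norm_add_le _ _
    have h3 := mul_le_mul_of_nonneg_left h2 K.coe_nonneg
    push_cast
    linarith
  have hgrowth : ∀ t ∈ Set.Icc (0 : ℝ) T, ∀ x,
      ‖F t x‖ ≤ (L * (1 + T * ‖a‖) + ‖a‖) * (1 + ‖x‖) := fun t ht x => by
    have h1 : ‖x + t • a‖ ≤ ‖x‖ + T * ‖a‖ := by
      refine (norm_add_le _ _).trans ?_
      rw [norm_smul, Real.norm_of_nonneg ht.1]
      gcongr
      exact ht.2
    have h2 : ‖F t x‖ ≤ L * (1 + (‖x‖ + T * ‖a‖)) + ‖a‖ :=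
      (norm_sub_le _ _).trans (by gcongr; exact (hfgrowth _).trans (by gcongr))
    have h3 : 0 ≤ L * (T * ‖a‖) * ‖x‖ := by positivity
    have h4 : 0 ≤ ‖a‖ * ‖x‖ := by positivity
    linarith
  constructor
  · have := UniformSpace.secondCountable_of_separable H
    obtain ⟨G, hG, hmem, hnormal⟩ := exists_solution_of_dirProxRegular hr (by positivity)
      hT.le hC₀closed hF hgrowth hC₀prox hu₀
    refine ⟨fun t => (u₀ + ∫ s in (0 : ℝ)..t, G s) + t • a, fun t => G t + a,
      hG.add (integrable_const a), fun t ht => ?_, fun t ht => ⟨_, hmem t ht, rfl⟩, ?_⟩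
    · simp only [intervalIntegral_add_const hG a ht, add_assoc]
    · filter_upwards [hnormal] with t ht
      rw [mem_proxNormalCone_image_add_iff]
      convert ht using 1
      simp only [hFdef]
      abel
  · intro u v hu hv t ht
    obtain ⟨g₁, hg₁, hu₁, hm₁, hn₁⟩ := hu.exists_fixed
    obtain ⟨g₂, hg₂, hv₂, hm₂, hn₂⟩ := hv.exists_fixed
    rw [hu₁ t ht, hv₂ t ht]
    exact congrArg (· + t • a)
      (eqOn_of_dirProxRegular hr hF hC₀prox hg₁ hg₂ hm₁ hm₂ hn₁ hn₂ ht)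
end
end
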